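/- arXiv:math/0607697 — 2 statements merged into one kernel-verified Lean document; each statement's English description precedes it below -/
import Mathlib

section
/- Let F : ℝ^n ⇉ ℝ^m be a definable set-valued mapping. Then the rate of surjection sur F is a definable extended-real-valued function whose domain is contained in the closure of Graph F; concretely, the sets {(x,y,α) ∈ ℝ^n × ℝ^m × ℝ : (x,y) ∈ cl(Graph F) and α = sur F(x|y)} and {(x,y) ∈ cl(Graph F) : sur F(x|y) = +∞} are definable. If F is tame, then these two sets are tame. -/
open Filter Metric Set Topology FirstOrder
open scoped ENNReal NNReal

noncomputable section

/-- The modulus of surjection `Sur F(x,y)(λ)`: the supremum of the radii `r ∈ [0,∞]`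
such that the closed ball of radius `r` around `y` is contained in the image under `F`
of the closed ball of radius `lam` around `x` (with `sup ∅ = 0`). -/
def surMod {X Y : Type*} [PseudoMetricSpace X] [PseudoMetricSpace Y]
    (F : X → Set Y) (x : X) (y : Y) (lam : ℝ) : ℝ≥0∞ :=
  sSup {r : ℝ≥0∞ | {v : Y | edist v y ≤ r} ⊆ ⋃ u ∈ Metric.closedBall x lam, F u}

/-- The rate of surjection `sur F(x̄|ȳ) = liminf_{(x,y,λ)→(x̄,ȳ,0+)} Sur F(x,y)(λ)/λ`. -/
def surRate {X Y : Type*} [PseudoMetricSpace X] [PseudoMetricSpace Y]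
    (F : X → Set Y) (xb : X) (yb : Y) : ℝ≥0∞ :=
  Filter.liminf
    (fun p : (X × Y) × ℝ => surMod F p.1.1 p.1.2 p.2 / ENNReal.ofReal p.2)
    ((𝓝 (xb, yb)) ×ˢ (𝓝[>] (0 : ℝ)))

/-- The graph of a set-valued mapping. -/
def svGraph {X Y : Type*} (F : X → Set Y) : Set (X × Y) := {p | p.2 ∈ F p.1}

/-- `y` is a critical value of `F` : there is `x` with `y ∈ F(x)` and `sur F(x|y) = 0`. -/
def IsCriticalValue {X Y : Type*} [PseudoMetricSpace X] [PseudoMetricSpace Y]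
    (F : X → Set Y) (y : Y) : Prop :=
  ∃ x, y ∈ F x ∧ surRate F x y = 0

/-- Definability (with parameters from `ℝ`) of a set of tuples. -/
def DefinableT (L : FirstOrder.Language) [L.Structure ℝ] {α : Type}
    (s : Set (α → ℝ)) : Prop :=
  (Set.univ : Set ℝ).Definable L s

/-- The o-minimality hypotheses: the order, addition and multiplication are definable and
every definable subset of `ℝ` is a finite union of points and open intervals. -/
structure IsOMinimalOn (L : FirstOrder.Language) [L.Structure ℝ] : Prop where
  definable_lt : DefinableT L {v : Fin 2 → ℝ | v 0 < v 1}
  definable_add : DefinableT L {v : Fin 3 → ℝ | v 2 = v 0 + v 1}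
  definable_mul : DefinableT L {v : Fin 3 → ℝ | v 2 = v 0 * v 1}
  finite_union : ∀ s : Set ℝ, DefinableT L {v : Fin 1 → ℝ | v 0 ∈ s} →
    ∃ (P : Finset ℝ) (I : Finset (EReal × EReal)),
      s = ↑P ∪ ⋃ p ∈ (I : Set (EReal × EReal)), {x : ℝ | p.1 < (x : EReal) ∧ (x : EReal) < p.2}

/-- Coding of a subset of `ℝⁿ × ℝᵐ` as a set of tuples. -/
def codeProd {n m : ℕ} (S : Set (EuclideanSpace ℝ (Fin n) × EuclideanSpace ℝ (Fin m))) :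
    Set (Fin n ⊕ Fin m → ℝ) :=
  {v | ((WithLp.equiv 2 (Fin n → ℝ)).symm fun i => v (Sum.inl i),
        (WithLp.equiv 2 (Fin m → ℝ)).symm fun j => v (Sum.inr j)) ∈ S}

/-- Coding of a subset of `ℝᵐ` as a set of tuples. -/
def codeE {m : ℕ} (S : Set (EuclideanSpace ℝ (Fin m))) : Set (Fin m → ℝ) :=
  {v | (WithLp.equiv 2 (Fin m → ℝ)).symm v ∈ S}

/-- A set of tuples is tame if its intersection with every bounded definable set is
definable. -/
def TameT (L : FirstOrder.Language) [L.Structure ℝ] {α : Type} [Fintype α]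
    (s : Set (α → ℝ)) : Prop :=
  ∀ b : Set (α → ℝ), DefinableT L b → Bornology.IsBounded b → DefinableT L (s ∩ b)

/-- A porous set in a metric space. -/
def Porous {X : Type*} [PseudoMetricSpace X] (Q : Set X) : Prop :=
  ∃ lam > (0 : ℝ), ∀ x ∈ Q, ∀ r > (0 : ℝ),
    ∃ z, Metric.ball z (lam * r) ⊆ Metric.ball x r \ Q

/-- A σ-porous set: a countable union of porous sets. -/
def SigmaPorous {X : Type*} [PseudoMetricSpace X] (Q : Set X) : Prop :=
  ∃ f : ℕ → Set X, (∀ i, Porous (f i)) ∧ Q = ⋃ i, f i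

/-- Coding of a subset of `(ℝⁿ × ℝᵐ) × ℝ` as a set of tuples. -/
def codeProdR {n m : ℕ}
    (S : Set ((EuclideanSpace ℝ (Fin n) × EuclideanSpace ℝ (Fin m)) × ℝ)) :
    Set ((Fin n ⊕ Fin m) ⊕ Fin 1 → ℝ) :=
  {v | (((WithLp.equiv 2 (Fin n → ℝ)).symm fun i => v (Sum.inl (Sum.inl i)),
         (WithLp.equiv 2 (Fin m → ℝ)).symm fun j => v (Sum.inl (Sum.inr j))),
        v (Sum.inr 0)) ∈ S}

theorem DefinableT.comp {L : FirstOrder.Language} [L.Structure ℝ] {α β : Type}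
    {s : Set (α → ℝ)} (hs : DefinableT L s) (f : α → β) :
    DefinableT L {w : β → ℝ | (fun i => w (f i)) ∈ s} :=
  Set.Definable.preimage_comp f hs

namespace DefinableT

variable {L : FirstOrder.Language} [L.Structure ℝ] {α β : Type}

theorem and {p q : (α → ℝ) → Prop} (hp : DefinableT L {v | p v}) (hq : DefinableT L {v | q v}) :
    DefinableT L {v | p v ∧ q v} :=
  Set.Definable.inter hp hq

theorem not {p : (α → ℝ) → Prop} (hp : DefinableT L {v | p v}) :
    DefinableT L {v | ¬ p v} :=
  Set.Definable.compl hp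

theorem imp {p q : (α → ℝ) → Prop} (hp : DefinableT L {v | p v}) (hq : DefinableT L {v | q v}) :
    DefinableT L {v | p v → q v} := by
  have h := (hp.and hq.not).not
  simpa only [not_and, not_not] using h

theorem forall_mem {ι : Type} [Finite ι] {p : ι → (α → ℝ) → Prop}
    (hp : ∀ i, DefinableT L {v | p i v}) : DefinableT L {v | ∀ i, p i v} := by
  have h := Set.definable_iInter_of_finite hp
  have e : {v | ∀ i, p i v} = ⋂ i, {v | p i v} := by ext v; simp
  rw [DefinableT, e]
  exact h

theorem ex [Finite β] {p : (α → ℝ) → (β → ℝ) → Prop}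
    (h : DefinableT L {w : α ⊕ β → ℝ | p (fun i => w (Sum.inl i)) (fun i => w (Sum.inr i))}) :
    DefinableT L {v | ∃ u, p v u} := by
  exact Set.Definable.exists_of_finite h

theorem exReal {p : (α → ℝ) → ℝ → Prop}
    (h : DefinableT L {w : α ⊕ Fin 1 → ℝ | p (fun i => w (Sum.inl i)) (w (Sum.inr 0))}) :
    DefinableT L {v | ∃ t, p v t} := by
  have h' := ex (p := fun v u => p v (u (0 : Fin 1))) h
  convert h' using 4
  exact ⟨fun ⟨t, ht⟩ => ⟨fun _ => t, ht⟩, fun ⟨u, hu⟩ => ⟨_, hu⟩⟩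

theorem allReal {p : (α → ℝ) → ℝ → Prop}
    (h : DefinableT L {w : α ⊕ Fin 1 → ℝ | p (fun i => w (Sum.inl i)) (w (Sum.inr 0))}) :
    DefinableT L {v | ∀ t, p v t} := by
  have h' := (exReal (p := fun v t => ¬ p v t) h.not).not
  simpa only [not_exists, not_not] using h'

theorem exEuclidean {k : ℕ} {p : (α → ℝ) → EuclideanSpace ℝ (Fin k) → Prop}
    (h : DefinableT L {w : α ⊕ Fin k → ℝ |
      p (fun i => w (Sum.inl i)) (WithLp.toLp 2 fun i => w (Sum.inr i))}) :
    DefinableT L {v | ∃ u, p v u} := by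
  have h' := ex (p := fun v u => p v (WithLp.toLp 2 u)) h
  convert h' using 4
  exact ⟨fun ⟨t, ht⟩ => ⟨WithLp.ofLp t, ht⟩, fun ⟨u, hu⟩ => ⟨_, hu⟩⟩

theorem allEuclidean {k : ℕ} {p : (α → ℝ) → EuclideanSpace ℝ (Fin k) → Prop}
    (h : DefinableT L {w : α ⊕ Fin k → ℝ |
      p (fun i => w (Sum.inl i)) (WithLp.toLp 2 fun i => w (Sum.inr i))}) :
    DefinableT L {v | ∀ u, p v u} := by
  have h' := (exEuclidean (p := fun v t => ¬ p v t) h.not).not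
  simpa only [not_exists, not_not] using h'

end DefinableT

/-- A real function of a tuple is definable if its graph is. -/
def DefinableFunT (L : FirstOrder.Language) [L.Structure ℝ] {α : Type}
    (f : (α → ℝ) → ℝ) : Prop :=
  DefinableT L {w : α ⊕ Fin 1 → ℝ | w (Sum.inr 0) = f fun i => w (Sum.inl i)}

namespace DefinableFunT

variable {L : FirstOrder.Language} [L.Structure ℝ] {α : Type}

theorem eval (i : α) : DefinableFunT L fun w => w i :=
  ⟨(Language.Term.var (Sum.inr 0)).equal (Language.Term.var (Sum.inl i)), by
    ext v; simp [Language.Formula.realize_equal]⟩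

theorem const (r : ℝ) : DefinableFunT L fun _ : α → ℝ => r :=
  ⟨(Language.Term.var (Sum.inr 0)).equal
    (L.con (⟨r, Set.mem_univ r⟩ : (Set.univ : Set ℝ))).term, by
    ext v; simp [Language.Formula.realize_equal]⟩

/-- Substituting two definable functions into a definable binary relation. -/
theorem rel {f g : (α → ℝ) → ℝ} (hf : DefinableFunT L f) (hg : DefinableFunT L g)
    {r : ℝ → ℝ → Prop} (hr : DefinableT L {v : Fin 2 → ℝ | r (v 0) (v 1)}) :
    DefinableT L {w | r (f w) (g w)} := by
  have h : DefinableT L {w : α → ℝ | ∃ a, a = f w ∧ ∃ b, b = g w ∧ r a b} := by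
    refine .exReal (.and hf (.exReal (.and ?_ ?_)))
    · exact hg.comp (Sum.elim (fun i => Sum.inl (Sum.inl i)) Sum.inr)
    · exact hr.comp ![Sum.inl (Sum.inr 0), Sum.inr 0]
  simpa only [exists_eq_left] using h

/-- Substituting two definable functions into a definable binary operation. -/
theorem op {f g : (α → ℝ) → ℝ} (hf : DefinableFunT L f) (hg : DefinableFunT L g)
    {o : ℝ → ℝ → ℝ} (ho : DefinableT L {v : Fin 3 → ℝ | v 2 = o (v 0) (v 1)}) :
    DefinableFunT L fun w => o (f w) (g w) := by
  have h : DefinableT L {w : α ⊕ Fin 1 → ℝ | ∃ a, a = f (fun i => w (Sum.inl i)) ∧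
      ∃ b, b = g (fun i => w (Sum.inl i)) ∧ w (Sum.inr 0) = o a b} := by
    refine .exReal (.and ?_ (.exReal (.and ?_ ?_)))
    · exact hf.comp (Sum.elim (fun i => Sum.inl (Sum.inl i)) Sum.inr)
    · exact hg.comp (Sum.elim (fun i => Sum.inl (Sum.inl (Sum.inl i))) Sum.inr)
    · exact ho.comp ![Sum.inl (Sum.inr 0), Sum.inr 0, Sum.inl (Sum.inl (Sum.inr 0))]
  simpa only [DefinableFunT, exists_eq_left] using h

end DefinableFunT

namespace IsOMinimalOn

variable {L : FirstOrder.Language} [L.Structure ℝ] {α : Type} {f g : (α → ℝ) → ℝ}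

theorem lt (hL : IsOMinimalOn L) (hf : DefinableFunT L f) (hg : DefinableFunT L g) :
    DefinableT L {w | f w < g w} :=
  hf.rel hg hL.definable_lt

theorem le (hL : IsOMinimalOn L) (hf : DefinableFunT L f) (hg : DefinableFunT L g) :
    DefinableT L {w | f w ≤ g w} := by
  simpa only [not_lt] using (hL.lt hg hf).not

theorem add (hL : IsOMinimalOn L) (hf : DefinableFunT L f) (hg : DefinableFunT L g) :
    DefinableFunT L fun w => f w + g w :=
  hf.op hg hL.definable_add

theorem mul (hL : IsOMinimalOn L) (hf : DefinableFunT L f) (hg : DefinableFunT L g) :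
    DefinableFunT L fun w => f w * g w :=
  hf.op hg hL.definable_mul

theorem sub (hL : IsOMinimalOn L) (hf : DefinableFunT L f) (hg : DefinableFunT L g) :
    DefinableFunT L fun w => f w - g w := by
  simpa only [neg_one_mul, ← sub_eq_add_neg] using
    hL.add hf (hL.mul (DefinableFunT.const (-1)) hg)

theorem sum (hL : IsOMinimalOn L) {ι : Type} (s : Finset ι) {f : ι → (α → ℝ) → ℝ}
    (hf : ∀ i, DefinableFunT L (f i)) : DefinableFunT L fun w => ∑ i ∈ s, f i w := by
  classical
  induction s using Finset.induction_on with
  | empty => simpa using DefinableFunT.const 0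
  | insert i s hi ih => simpa only [Finset.sum_insert hi] using hL.add (hf i) ih

theorem dist_le (hL : IsOMinimalOn L) {k : ℕ} (σ τ : Fin k → α) (hf : DefinableFunT L f) :
    DefinableT L {w | dist (WithLp.toLp 2 fun i => w (σ i) : EuclideanSpace ℝ (Fin k))
      (WithLp.toLp 2 fun i => w (τ i)) ≤ f w} := by
  have hd (i : Fin k) : DefinableFunT L fun w : α → ℝ => w (σ i) - w (τ i) :=
    hL.sub (.eval _) (.eval _)
  have h := (hL.le (.const 0) hf).and
    (hL.le (hL.sum Finset.univ fun i => hL.mul (hd i) (hd i)) (hL.mul hf hf))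
  convert h using 3 with w
  rw [EuclideanSpace.dist_eq, Real.sqrt_le_iff]
  simp only [Real.dist_eq, sq_abs, ← sq]

theorem dist_lt (hL : IsOMinimalOn L) {k : ℕ} (σ τ : Fin k → α) (hf : DefinableFunT L f) :
    DefinableT L {w | dist (WithLp.toLp 2 fun i => w (σ i) : EuclideanSpace ℝ (Fin k))
      (WithLp.toLp 2 fun i => w (τ i)) < f w} := by
  have hd (i : Fin k) : DefinableFunT L fun w : α → ℝ => w (σ i) - w (τ i) :=
    hL.sub (.eval _) (.eval _)
  have h := (hL.lt (.const 0) hf).and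
    (hL.lt (hL.sum Finset.univ fun i => hL.mul (hd i) (hd i)) (hL.mul hf hf))
  convert h using 3 with w
  have hw : 0 ≤ ∑ i, dist (w (σ i)) (w (τ i)) ^ 2 := Finset.sum_nonneg fun i _ => sq_nonneg _
  rw [EuclideanSpace.dist_eq]
  simp only [Real.dist_eq, sq_abs, ← sq] at hw ⊢
  constructor
  · intro h0
    have hp := (Real.sqrt_nonneg _).trans_lt h0
    exact ⟨hp, (Real.sqrt_lt' hp).1 h0⟩
  · rintro ⟨hp, h1⟩
    exact (Real.sqrt_lt' hp).2 h1

end IsOMinimalOn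

section RateOfSurjection

variable {X Y : Type*} [PseudoMetricSpace X] [PseudoMetricSpace Y]

/-- Near `(x, y)` the mapping `F` is open at a linear rate `c`. -/
def OpenAtRate (F : X → Set Y) (x : X) (y : Y) (c : ℝ) : Prop :=
  ∃ ε : ℝ, 0 < ε ∧ ∀ x', dist x' x < ε → ∀ y', dist y' y < ε → ∀ l : ℝ, 0 < l → l < ε →
    ∀ v, dist v y' ≤ c * l → ∃ u, dist u x' ≤ l ∧ v ∈ F u

theorem OpenAtRate.le_surRate {F : X → Set Y} {x : X} {y : Y} {c : ℝ} (hc : 0 ≤ c)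
    (h : OpenAtRate F x y c) : ENNReal.ofReal c ≤ surRate F x y := by
  obtain ⟨ε, hε, h⟩ := h
  refine le_liminf_of_le (by isBoundedDefault) ?_
  filter_upwards [prod_mem_prod (Metric.ball_mem_nhds (x, y) hε) (Ioo_mem_nhdsGT hε)]
  rintro ⟨⟨x', y'⟩, l⟩ ⟨hxy, hl0, hl⟩
  rw [Metric.mem_ball, Prod.dist_eq, max_lt_iff] at hxy
  rw [ENNReal.le_div_iff_mul_le (Or.inl (by simpa using hl0)) (Or.inl ENNReal.ofReal_ne_top),
    ← ENNReal.ofReal_mul hc]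
  refine le_sSup fun v hv => ?_
  obtain ⟨u, hu, hvu⟩ := h x' hxy.1 y' hxy.2 l hl0 hl v
    ((edist_le_ofReal (mul_nonneg hc hl0.le)).1 hv)
  exact mem_iUnion₂.2 ⟨u, hu, hvu⟩

theorem openAtRate_of_lt_surRate {F : X → Set Y} {x : X} {y : Y} {c : ℝ} (hc : 0 ≤ c)
    (h : ENNReal.ofReal c < surRate F x y) : OpenAtRate F x y c := by
  have h' := eventually_lt_of_lt_liminf h
  obtain ⟨s, hs, t, ht, hst⟩ := mem_prod_iff.1 h'
  obtain ⟨ε₁, hε₁, hs⟩ := Metric.mem_nhds_iff.1 hs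
  obtain ⟨ε₂, hε₂, ht⟩ := mem_nhdsGT_iff_exists_Ioo_subset.1 ht
  refine ⟨min ε₁ ε₂, lt_min hε₁ hε₂, fun x' hx y' hy l hl0 hl v hv => ?_⟩
  have hxy : (x', y') ∈ s := hs <| by
    rw [Metric.mem_ball, Prod.dist_eq, max_lt_iff]
    exact ⟨hx.trans_le (min_le_left _ _), hy.trans_le (min_le_left _ _)⟩
  have hr := @hst ((x', y'), l) ⟨hxy, ht ⟨hl0, hl.trans_le (min_le_right _ _)⟩⟩
  change ENNReal.ofReal c < surMod F x' y' l / ENNReal.ofReal l at hr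
  rw [ENNReal.lt_div_iff_mul_lt (Or.inl (by simpa using hl0)) (Or.inl ENNReal.ofReal_ne_top),
    ← ENNReal.ofReal_mul hc] at hr
  obtain ⟨r, hr, hlt⟩ := lt_sSup_iff.1 hr
  obtain ⟨u, hu, hvu⟩ := mem_iUnion₂.1 <|
    @hr v (((edist_le_ofReal (mul_nonneg hc hl0.le)).2 hv).trans hlt.le)
  exact ⟨u, hu, hvu⟩

theorem surRate_eq_top_iff {F : X → Set Y} {x : X} {y : Y} :
    surRate F x y = ⊤ ↔ ∀ c : ℝ, 0 ≤ c → OpenAtRate F x y c := by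
  constructor
  · intro h c hc
    exact openAtRate_of_lt_surRate hc (h ▸ ENNReal.ofReal_lt_top)
  · intro h
    refine ENNReal.eq_top_of_forall_nnreal_le fun r => ?_
    simpa using (h r r.2).le_surRate r.2

theorem surRate_eq_ofReal_iff {F : X → Set Y} {x : X} {y : Y} {a : ℝ} (ha : 0 ≤ a) :
    surRate F x y = ENNReal.ofReal a ↔
      (∀ c : ℝ, 0 ≤ c → c < a → OpenAtRate F x y c) ∧
        ∀ c : ℝ, a < c → ¬ OpenAtRate F x y c := by
  constructor
  · intro h
    refine ⟨fun c hc hca => openAtRate_of_lt_surRate hc ?_, fun c hc ho => ?_⟩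
    · rw [h]
      exact (ENNReal.ofReal_lt_ofReal_iff_of_nonneg hc).2 hca
    · have h1 := ho.le_surRate (ha.trans hc.le)
      rw [h, ENNReal.ofReal_le_ofReal_iff ha] at h1
      exact hc.not_ge h1
  · rintro ⟨h1, h2⟩
    refine le_antisymm (le_of_not_gt fun hlt => ?_) (le_of_forall_lt fun b hb => ?_)
    · obtain ⟨c, hac, hc⟩ := ENNReal.lt_iff_exists_nnreal_btwn.1 hlt
      refine h2 c ?_ (openAtRate_of_lt_surRate c.2 (by simpa using hc))
      exact (ENNReal.ofReal_lt_coe_iff ha).1 hac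
    · obtain ⟨c, hbc, hc⟩ := ENNReal.lt_iff_exists_nnreal_btwn.1 hb
      refine hbc.trans_le ?_
      have hca : (c : ℝ) < a := by
        rw [← ENNReal.ofReal_coe_nnreal] at hc
        exact (ENNReal.ofReal_lt_ofReal_iff_of_nonneg c.2).1 hc
      simpa using (h1 c c.2 hca).le_surRate c.2

theorem ne_top_and_eq_toReal_iff {t : ℝ≥0∞} {a : ℝ} :
    t ≠ ⊤ ∧ a = t.toReal ↔ 0 ≤ a ∧ t = ENNReal.ofReal a := by
  constructor
  · rintro ⟨ht, rfl⟩
    exact ⟨ENNReal.toReal_nonneg, (ENNReal.ofReal_toReal ht).symm⟩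
  · rintro ⟨ha, rfl⟩
    exact ⟨ENNReal.ofReal_ne_top, (ENNReal.toReal_ofReal ha).symm⟩

theorem OpenAtRate.of_local {F G : X → Set Y} {x : X} {y : Y} {c δ : ℝ} (hc : 0 ≤ c) (hδ : 0 < δ)
    (h : ∀ u v, dist u x < δ → dist v y < δ → v ∈ F u → v ∈ G u)
    (hF : OpenAtRate F x y c) : OpenAtRate G x y c := by
  obtain ⟨ε, hε, hF⟩ := hF
  have hc1 : 0 < c + 1 := by linarith
  refine ⟨min ε (δ / (c + 1) / 2), by positivity, fun x' hx y' hy l hl0 hl v hv => ?_⟩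
  rw [lt_min_iff] at hx hy hl
  obtain ⟨u, hu, hvu⟩ := hF x' hx.1 y' hy.1 l hl0 hl.1 v hv
  have hδc : (c + 1) * (δ / (c + 1) / 2) = δ / 2 := by field_simp
  have hκ : 0 < δ / (c + 1) / 2 := by positivity
  have hle := mul_le_mul_of_nonneg_left hl.2.le hc
  have hnn := mul_nonneg hc hκ.le
  refine ⟨u, hu, h u v ?_ ?_ hvu⟩
  · linarith [dist_triangle u x' x]
  · linarith [dist_triangle v y' y]

theorem surRate_le_of_local {F G : X → Set Y} {x : X} {y : Y} {δ : ℝ} (hδ : 0 < δ)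
    (h : ∀ u v, dist u x < δ → dist v y < δ → v ∈ F u → v ∈ G u) :
    surRate F x y ≤ surRate G x y := by
  refine le_of_forall_lt fun b hb => ?_
  obtain ⟨c, hbc, hc⟩ := ENNReal.lt_iff_exists_nnreal_btwn.1 hb
  have ho := openAtRate_of_lt_surRate c.2 (by simpa using hc)
  exact hbc.trans_le (by simpa using (ho.of_local c.2 hδ h).le_surRate c.2)

theorem surRate_congr_of_local {F G : X → Set Y} {x : X} {y : Y} {δ : ℝ} (hδ : 0 < δ)
    (h : ∀ u v, dist u x < δ → dist v y < δ → (v ∈ F u ↔ v ∈ G u)) :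
    surRate F x y = surRate G x y :=
  le_antisymm (surRate_le_of_local hδ fun u v hu hv => (h u v hu hv).1)
    (surRate_le_of_local hδ fun u v hu hv => (h u v hu hv).2)

theorem mem_closure_svGraph_iff {F : X → Set Y} {x : X} {y : Y} :
    (x, y) ∈ closure (svGraph F) ↔
      ∀ ε : ℝ, 0 < ε → ∃ u, dist u x < ε ∧ ∃ v, dist v y < ε ∧ v ∈ F u := by
  simp only [Metric.mem_closure_iff, Prod.exists, Prod.dist_eq, max_lt_iff, svGraph,
    mem_ofPred_eq, dist_comm x, dist_comm y]
  refine forall₂_congr fun ε _ => ⟨?_, ?_⟩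
  · rintro ⟨u, v, h, hu, hv⟩
    exact ⟨u, hu, v, hv, h⟩
  · rintro ⟨u, hu, v, hv, h⟩
    exact ⟨u, v, h, hu, hv⟩

theorem mem_closure_svGraph_congr_of_local {F G : X → Set Y} {x : X} {y : Y} {δ : ℝ} (hδ : 0 < δ)
    (h : ∀ u v, dist u x < δ → dist v y < δ → (v ∈ F u ↔ v ∈ G u)) :
    (x, y) ∈ closure (svGraph F) ↔ (x, y) ∈ closure (svGraph G) := by
  have key : ∀ {F G : X → Set Y},
      (∀ u v, dist u x < δ → dist v y < δ → v ∈ F u → v ∈ G u) →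
      (x, y) ∈ closure (svGraph F) → (x, y) ∈ closure (svGraph G) := by
    intro F G h hF
    rw [mem_closure_svGraph_iff] at hF ⊢
    intro ε hε
    obtain ⟨u, hu, v, hv, hvu⟩ := hF (min ε δ) (lt_min hε hδ)
    rw [lt_min_iff] at hu hv
    exact ⟨u, hu.1, v, hv.1, h u v hu.2 hv.2 hvu⟩
  exact ⟨key fun u v hu hv => (h u v hu hv).1, key fun u v hu hv => (h u v hu hv).2⟩

end RateOfSurjection

section Definability

variable {L : FirstOrder.Language} [L.Structure ℝ] {n m : ℕ}
  {F : EuclideanSpace ℝ (Fin n) → Set (EuclideanSpace ℝ (Fin m))}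

theorem DefinableT.mem_svGraph (hF : DefinableT L (codeProd (svGraph F))) {γ : Type}
    (σ : Fin n → γ) (τ : Fin m → γ) :
    DefinableT L {w : γ → ℝ | (WithLp.toLp 2 fun j => w (τ j) : EuclideanSpace ℝ (Fin m)) ∈
      F (WithLp.toLp 2 fun i => w (σ i))} :=
  hF.comp (Sum.elim σ τ)

theorem IsOMinimalOn.openAtRate (hL : IsOMinimalOn L)
    (hF : DefinableT L (codeProd (svGraph F))) {γ : Type}
    (σ : Fin n → γ) (τ : Fin m → γ) (k : γ) :
    DefinableT L {w : γ → ℝ | OpenAtRate F (WithLp.toLp 2 fun i => w (σ i))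
      (WithLp.toLp 2 fun j => w (τ j)) (w k)} := by
  unfold OpenAtRate
  refine .exReal (.and (hL.lt (.const 0) (.eval _)) ?_)
  refine .allEuclidean (.imp ?_ (.allEuclidean (.imp ?_ ?_)))
  · exact hL.dist_lt Sum.inr (fun i => Sum.inl (Sum.inl (σ i))) (.eval (Sum.inl (Sum.inr 0)))
  · exact hL.dist_lt Sum.inr (fun j => Sum.inl (Sum.inl (Sum.inl (τ j))))
      (.eval (Sum.inl (Sum.inl (Sum.inr 0))))
  refine .allReal (.imp (hL.lt (.const 0) (.eval _)) (.imp ?_ (.allEuclidean (.imp ?_ ?_))))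
  · exact hL.lt (.eval (Sum.inr 0)) (.eval (Sum.inl (Sum.inl (Sum.inl (Sum.inr 0)))))
  · exact hL.dist_le Sum.inr (fun j => Sum.inl (Sum.inl (Sum.inr j)))
      (hL.mul (.eval (Sum.inl (Sum.inl (Sum.inl (Sum.inl (Sum.inl k))))))
        (.eval (Sum.inl (Sum.inr 0))))
  refine .exEuclidean (.and ?_ ?_)
  · exact hL.dist_le Sum.inr (fun i => Sum.inl (Sum.inl (Sum.inl (Sum.inl (Sum.inr i)))))
      (.eval (Sum.inl (Sum.inl (Sum.inr 0))))
  · exact hF.mem_svGraph Sum.inr (fun j => Sum.inl (Sum.inr j))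

theorem IsOMinimalOn.mem_closure_svGraph (hL : IsOMinimalOn L)
    (hF : DefinableT L (codeProd (svGraph F))) {γ : Type} (σ : Fin n → γ) (τ : Fin m → γ) :
    DefinableT L {w : γ → ℝ | ((WithLp.toLp 2 fun i => w (σ i) : EuclideanSpace ℝ (Fin n)),
      (WithLp.toLp 2 fun j => w (τ j) : EuclideanSpace ℝ (Fin m))) ∈ closure (svGraph F)} := by
  simp only [mem_closure_svGraph_iff]
  refine .allReal (.imp (hL.lt (.const 0) (.eval _)) (.exEuclidean (.and ?_
    (.exEuclidean (.and ?_ ?_)))))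
  · exact hL.dist_lt Sum.inr (fun i => Sum.inl (Sum.inl (σ i))) (.eval (Sum.inl (Sum.inr 0)))
  · exact hL.dist_lt Sum.inr (fun j => Sum.inl (Sum.inl (Sum.inl (τ j))))
      (.eval (Sum.inl (Sum.inl (Sum.inr 0))))
  · exact hF.mem_svGraph (fun i => Sum.inl (Sum.inr i)) Sum.inr

theorem IsOMinimalOn.surRate_eq_top (hL : IsOMinimalOn L)
    (hF : DefinableT L (codeProd (svGraph F))) :
    DefinableT L (codeProd {p | p ∈ closure (svGraph F) ∧ surRate F p.1 p.2 = ⊤}) := by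
  simp only [surRate_eq_top_iff]
  refine .and (hL.mem_closure_svGraph hF Sum.inl Sum.inr)
    (.allReal (.imp (hL.le (.const 0) (.eval _)) ?_))
  exact hL.openAtRate hF (fun i => Sum.inl (Sum.inl i)) (fun j => Sum.inl (Sum.inr j)) (Sum.inr 0)

theorem IsOMinimalOn.graph_surRate (hL : IsOMinimalOn L)
    (hF : DefinableT L (codeProd (svGraph F))) :
    DefinableT L (codeProdR {q | q.1 ∈ closure (svGraph F) ∧ surRate F q.1.1 q.1.2 ≠ ⊤ ∧
      q.2 = (surRate F q.1.1 q.1.2).toReal}) := by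
  simp only [ne_top_and_eq_toReal_iff]
  have h : DefinableT L (codeProdR {q | q.1 ∈ closure (svGraph F) ∧ 0 ≤ q.2 ∧
      (∀ c : ℝ, 0 ≤ c → c < q.2 → OpenAtRate F q.1.1 q.1.2 c) ∧
        ∀ c : ℝ, q.2 < c → ¬ OpenAtRate F q.1.1 q.1.2 c}) := by
    have ho := hL.openAtRate hF (γ := ((Fin n ⊕ Fin m) ⊕ Fin 1) ⊕ Fin 1)
      (fun i => Sum.inl (Sum.inl (Sum.inl i))) (fun j => Sum.inl (Sum.inl (Sum.inr j)))
      (Sum.inr 0)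
    refine .and (hL.mem_closure_svGraph hF (fun i => Sum.inl (Sum.inl i))
      fun j => Sum.inl (Sum.inr j)) (.and (hL.le (.const 0) (.eval _)) (.and ?_ ?_))
    · exact .allReal (.imp (hL.le (.const 0) (.eval _))
        (.imp (hL.lt (.eval _) (.eval (Sum.inl (Sum.inr 0)))) ho))
    · exact .allReal (.imp (hL.lt (.eval (Sum.inl (Sum.inr 0))) (.eval _)) ho.not)
  convert h using 5 with q
  exact and_congr_right fun ha => surRate_eq_ofReal_iff ha

/-- The restriction of `F` to the pairs all of whose coordinates lie in `(-R, R)`. -/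
def boxRestrict (F : EuclideanSpace ℝ (Fin n) → Set (EuclideanSpace ℝ (Fin m))) (R : ℝ) :
    EuclideanSpace ℝ (Fin n) → Set (EuclideanSpace ℝ (Fin m)) :=
  fun x => {y | y ∈ F x ∧ (∀ i, |x i| < R) ∧ ∀ j, |y j| < R}

theorem IsOMinimalOn.definable_boxRestrict (hL : IsOMinimalOn L)
    (hF : TameT L (codeProd (svGraph F))) (R : ℝ) :
    DefinableT L (codeProd (svGraph (boxRestrict F R))) := by
  have hb : DefinableT L {v : Fin n ⊕ Fin m → ℝ | ∀ i, -R < v i ∧ v i < R} :=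
    .forall_mem fun i => .and (hL.lt (.const _) (.eval _)) (hL.lt (.eval _) (.const _))
  have hbd : Bornology.IsBounded {v : Fin n ⊕ Fin m → ℝ | ∀ i, -R < v i ∧ v i < R} := by
    refine (Metric.isBounded_closedBall (x := 0) (r := |R|)).subset fun v hv => ?_
    rw [Metric.mem_closedBall, dist_pi_le_iff (abs_nonneg R)]
    intro i
    have h := abs_lt.2 (hv i)
    simpa using h.le.trans (le_abs_self R)
  convert hF _ hb hbd using 1
  ext v
  simp [codeProd, svGraph, boxRestrict, abs_lt]
  tauto

theorem mem_boxRestrict_iff_of_dist_lt {R : ℝ} {x u : EuclideanSpace ℝ (Fin n)}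
    {y v : EuclideanSpace ℝ (Fin m)} (hx : ∀ i, |x i| ≤ R) (hy : ∀ j, |y j| ≤ R)
    (hu : dist u x < 1) (hv : dist v y < 1) : v ∈ F u ↔ v ∈ boxRestrict F (R + 1) u := by
  have key {k : ℕ} {a b : EuclideanSpace ℝ (Fin k)} (hb : ∀ i, |b i| ≤ R) (hab : dist a b < 1)
      (i : Fin k) : |a i| < R + 1 := by
    have h1 : |a i - b i| < 1 := by
      rw [dist_eq_norm] at hab
      exact (PiLp.norm_apply_le (a - b) i).trans_lt hab
    have h2 := abs_add_le (a i - b i) (b i)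
    rw [sub_add_cancel] at h2
    linarith [hb i]
  exact ⟨fun h => ⟨h, key hx hu, key hy hv⟩, fun h => h.1⟩

theorem exists_forall_abs_le {α : Type} [Fintype α] {b : Set (α → ℝ)}
    (hb : Bornology.IsBounded b) : ∃ R : ℝ, ∀ v ∈ b, ∀ i, |v i| ≤ R := by
  obtain ⟨R, hR⟩ := isBounded_iff_forall_norm_le.1 hb
  exact ⟨R, fun v hv i => (norm_le_pi_norm v i).trans (hR v hv)⟩

end Definability

/-- **Proposition 1.** For a definable (resp. tame) set-valued mapping `F : ℝⁿ ⇉ ℝᵐ`, the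
rate of surjection `sur F` is a definable (resp. tame) extended-real-valued function: the
graph `{(x,y,α) : (x,y) ∈ cl(Graph F), α = sur F(x|y)}` (with `α` the real value at points
where `sur F` is finite) and the set `{(x,y) ∈ cl(Graph F) : sur F(x|y) = +∞}` are both
definable (resp. tame). -/
theorem surRate_definable_of_definable
    {n m : ℕ} (L : FirstOrder.Language) [L.Structure ℝ] (hL : IsOMinimalOn L)
    (F : EuclideanSpace ℝ (Fin n) → Set (EuclideanSpace ℝ (Fin m)))
    (A : Set ((EuclideanSpace ℝ (Fin n) × EuclideanSpace ℝ (Fin m)) × ℝ))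
    (hA : A = {q | q.1 ∈ closure (svGraph F) ∧ surRate F q.1.1 q.1.2 ≠ ⊤ ∧
      q.2 = (surRate F q.1.1 q.1.2).toReal})
    (B : Set (EuclideanSpace ℝ (Fin n) × EuclideanSpace ℝ (Fin m)))
    (hB : B = {p | p ∈ closure (svGraph F) ∧ surRate F p.1 p.2 = ⊤}) :
    (DefinableT L (codeProd (svGraph F)) →
      DefinableT L (codeProdR A) ∧ DefinableT L (codeProd B)) ∧
    (TameT L (codeProd (svGraph F)) →
      TameT L (codeProdR A) ∧ TameT L (codeProd B)) := by
  subst hA hB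
  refine ⟨fun hF => ⟨hL.graph_surRate hF, hL.surRate_eq_top hF⟩, fun hF => ⟨?_, ?_⟩⟩
  · intro b hb hbd
    obtain ⟨R, hR⟩ := exists_forall_abs_le hbd
    have h := (hL.graph_surRate (hL.definable_boxRestrict hF (R + 1))).and hb
    convert h using 1
    ext v
    refine and_congr_left fun hv => ?_
    have hloc := fun u w => mem_boxRestrict_iff_of_dist_lt (F := F) (u := u) (v := w)
      (x := WithLp.toLp 2 fun i => v (Sum.inl (Sum.inl i)))
      (y := WithLp.toLp 2 fun j => v (Sum.inl (Sum.inr j)))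
      (fun i => hR v hv _) (fun j => hR v hv _)
    simp only [codeProdR, mem_ofPred_eq, WithLp.equiv_symm_apply,
      mem_closure_svGraph_congr_of_local one_pos hloc, surRate_congr_of_local one_pos hloc]
  · intro b hb hbd
    obtain ⟨R, hR⟩ := exists_forall_abs_le hbd
    have h := (hL.surRate_eq_top (hL.definable_boxRestrict hF (R + 1))).and hb
    convert h using 1
    ext v
    refine and_congr_left fun hv => ?_
    have hloc := fun u w => mem_boxRestrict_iff_of_dist_lt (F := F) (u := u) (v := w)
      (x := WithLp.toLp 2 fun i => v (Sum.inl i)) (y := WithLp.toLp 2 fun j => v (Sum.inr j))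
      (fun i => hR v hv _) (fun j => hR v hv _)
    simp only [codeProd, mem_ofPred_eq, WithLp.equiv_symm_apply,
      mem_closure_svGraph_congr_of_local one_pos hloc, surRate_congr_of_local one_pos hloc]
end
end

section
/- (Uniform integrability lemma.) Let Q ⊆ ℝ^n be a definable set, let −∞ < a < b < ∞, and let φ : Q × (a,b) × (0,1) → ℝ be a definable function such that φ(x,t,s) → 0 as s → 0+ uniformly on Q × (a,b). For (x,s) ∈ Q × (0,1) let g(x,t,s) denote the derivative of the function t ↦ φ(x,t,s) at t whenever this derivative exists, and 0 otherwise (for each fixed (x,s) the derivative exists for all but finitely many t ∈ (a,b)). Then ∫_a^b |g(x,t,s)| dt → 0 as s → 0+, uniformly in x ∈ Q; that is, for every ε > 0 there is δ > 0 such that ∫_a^b |g(x,t,s)| dt ≤ ε for all x ∈ Q and all s ∈ (0,δ). -/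
open Filter Metric Set Topology FirstOrder
open scoped ENNReal NNReal

noncomputable section

/-- A predicate on tuples whose truth set is definable with parameters. -/
def DefPred (L : FirstOrder.Language) [L.Structure ℝ] {α : Type} (p : (α → ℝ) → Prop) : Prop :=
  DefinableT L {v | p v}

namespace DefPred

variable {L : FirstOrder.Language} [L.Structure ℝ] {α β : Type} {p q : (α → ℝ) → Prop}

theorem and (hp : DefPred L p) (hq : DefPred L q) : DefPred L fun v => p v ∧ q v :=
  Set.Definable.inter hp hq

theorem or (hp : DefPred L p) (hq : DefPred L q) : DefPred L fun v => p v ∨ q v :=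
  Set.Definable.union hp hq

theorem not (hp : DefPred L p) : DefPred L fun v => ¬ p v :=
  Set.Definable.compl hp

theorem imp (hp : DefPred L p) (hq : DefPred L q) : DefPred L fun v => p v → q v := by
  simpa only [imp_iff_not_or] using hp.not.or hq

theorem ex [Finite α] {r : (α → ℝ) → ℝ → Prop}
    (hr : DefPred L fun w : Option α → ℝ => r (fun i => w (some i)) (w none)) :
    DefPred L fun v => ∃ y, r v y := by
  have h := Set.Definable.image_comp (L := L) hr (some : α → Option α)
  refine (congrArg (DefinableT L) ?_).mp h
  ext v
  constructor
  · rintro ⟨w, hw, rfl⟩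
    exact ⟨w none, hw⟩
  · rintro ⟨y, hy⟩
    exact ⟨fun o => o.elim y v, hy, rfl⟩

theorem all [Finite α] {r : (α → ℝ) → ℝ → Prop}
    (hr : DefPred L fun w : Option α → ℝ => r (fun i => w (some i)) (w none)) :
    DefPred L fun v => ∀ y, r v y := by
  have h : DefPred L fun v => ¬ ∃ y, ¬ r v y := (ex hr.not).not
  simpa only [not_exists, not_not] using h

/-- Variables may be renamed or replaced by real constants. -/
theorem subst (hp : DefPred L p) (τ : α → β ⊕ ℝ) :
    DefPred L fun w : β → ℝ => p fun i => (τ i).elim w id := by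
  obtain ⟨φ, hφ⟩ := hp
  refine ⟨FirstOrder.Language.BoundedFormula.subst φ fun i =>
    (τ i).elim FirstOrder.Language.Term.var
      fun c => (L.con (⟨c, trivial⟩ : (Set.univ : Set ℝ))).term, ?_⟩
  ext w
  have h := Set.ext_iff.1 hφ fun i => (τ i).elim w id
  refine h.trans ?_
  simp only [Set.mem_ofPred_eq, FirstOrder.Language.Formula.Realize,
    FirstOrder.Language.BoundedFormula.realize_subst]
  have e : (fun i => (τ i).elim w id) = fun i => FirstOrder.Language.Term.realize
      (L := L[[(Set.univ : Set ℝ)]]) w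
      ((τ i).elim FirstOrder.Language.Term.var
        fun c => (L.con (⟨c, trivial⟩ : (Set.univ : Set ℝ))).term) := by
    funext i
    rcases τ i with j | c
    · rfl
    · exact (FirstOrder.Language.Term.realize_con (L := L) (A := (Set.univ : Set ℝ))
        (a := ⟨c, trivial⟩) (v := w)).symm
  rw [e]

theorem rename (hp : DefPred L p) (σ : α → β) : DefPred L fun w : β → ℝ => p fun i => w (σ i) :=
  hp.subst fun i => Sum.inl (σ i)

theorem const (c : Prop) : DefPred L fun _ : α → ℝ => c := by
  by_cases h : c
  · simp [DefPred, DefinableT, h]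
  · simp [DefPred, DefinableT, h]

theorem rel (r : (α → ℝ) → ℝ → Prop)
    (hr : DefPred L fun w : Option α → ℝ => r (fun i => w (some i)) (w none))
    (σ : α → β) (j : β) : DefPred L fun w : β → ℝ => r (fun i => w (σ i)) (w j) :=
  hr.rename fun o => o.elim j σ

theorem fiber (r : (α → ℝ) → ℝ → Prop)
    (hr : DefPred L fun w : Option α → ℝ => r (fun i => w (some i)) (w none))
    (v : α → ℝ) : DefPred L fun w : Fin 1 → ℝ => r v (w 0) :=
  hr.subst fun o => o.elim (Sum.inl 0) fun i => Sum.inr (v i)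

theorem rel₂ (r : (α → ℝ) → ℝ → ℝ → Prop)
    (hr : DefPred L fun w : Option (Option α) → ℝ =>
      r (fun i => w (some (some i))) (w (some none)) (w none))
    (σ : α → β) (j k : β) : DefPred L fun w : β → ℝ => r (fun i => w (σ i)) (w j) (w k) :=
  hr.rename fun o => o.elim k fun o' => o'.elim j σ

theorem lt (hL : IsOMinimalOn L) (i j : α) : DefPred L fun w : α → ℝ => w i < w j :=
  rename (p := fun v : Fin 2 → ℝ => v 0 < v 1) hL.definable_lt ![i, j]

theorem add (hL : IsOMinimalOn L) (k i j : α) : DefPred L fun w : α → ℝ => w k = w i + w j :=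
  rename (p := fun v : Fin 3 → ℝ => v 2 = v 0 + v 1) hL.definable_add ![i, j, k]

theorem const_lt (hL : IsOMinimalOn L) (c : ℝ) (i : α) : DefPred L fun w : α → ℝ => c < w i :=
  subst (p := fun v : Fin 2 → ℝ => v 0 < v 1) hL.definable_lt ![Sum.inr c, Sum.inl i]

theorem lt_const (hL : IsOMinimalOn L) (c : ℝ) (i : α) : DefPred L fun w : α → ℝ => w i < c :=
  subst (p := fun v : Fin 2 → ℝ => v 0 < v 1) hL.definable_lt ![Sum.inl i, Sum.inr c]

theorem eq_add_const (hL : IsOMinimalOn L) (k i : α) (c : ℝ) :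
    DefPred L fun w : α → ℝ => w k = w i + c :=
  subst (p := fun v : Fin 3 → ℝ => v 2 = v 0 + v 1) hL.definable_add
    ![Sum.inl i, Sum.inr c, Sum.inl k]

theorem eq_const (hL : IsOMinimalOn L) (i : α) (c : ℝ) : DefPred L fun w : α → ℝ => w i = c := by
  simpa using subst (p := fun v : Fin 3 → ℝ => v 2 = v 0 + v 1) hL.definable_add
    (β := α) ![Sum.inr c, Sum.inr 0, Sum.inl i]

theorem eq (hL : IsOMinimalOn L) (i j : α) : DefPred L fun w : α → ℝ => w i = w j := by
  simpa using eq_add_const hL i j 0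

theorem lt_add [Finite α] (hL : IsOMinimalOn L) (i j k : α) :
    DefPred L fun w : α → ℝ => w i < w j + w k := by
  have h : DefPred L fun w : α → ℝ => ∃ y, y = w j + w k ∧ w i < y :=
    ex ((add hL none (some j) (some k)).and (lt hL (some i) none))
  simpa using h

theorem add_eq_add [Finite α] (hL : IsOMinimalOn L) (i j k l : α) :
    DefPred L fun w : α → ℝ => w i + w j = w k + w l := by
  have h : DefPred L fun w : α → ℝ => ∃ y, y = w i + w j ∧ y = w k + w l :=
    ex ((add hL none (some i) (some j)).and (add hL none (some k) (some l)))
  simpa using h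

theorem ball_list {ι : Type*} (l : List ι) {r : ι → (α → ℝ) → Prop}
    (hr : ∀ i, DefPred L (r i)) : DefPred L fun v => ∃ i ∈ l, r i v := by
  induction l with
  | nil => simpa using const (L := L) (α := α) False
  | cons a l ih => simpa using (hr a).or ih

end DefPred

theorem frontier_finite_of_definable {L : FirstOrder.Language} [L.Structure ℝ]
    (hL : IsOMinimalOn L) {p : ℝ → Prop} (hp : DefPred L fun w : Fin 1 → ℝ => p (w 0)) :
    (frontier {x | p x}).Finite := by
  obtain ⟨P, I, h⟩ := hL.finite_union {x | p x} hp
  rw [h]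
  have hU : ∀ s t : Set ℝ, (frontier s).Finite → (frontier t).Finite →
      (frontier (s ∪ t)).Finite := fun s t hs ht =>
    (hs.union ht).subset ((frontier_union_subset s t).trans
      (Set.union_subset_union Set.inter_subset_left Set.inter_subset_right))
  refine hU _ _ (P.finite_toSet.subset P.finite_toSet.isClosed.frontier_subset) ?_
  clear h
  classical
  induction I using Finset.induction_on with
  | empty => simp
  | insert e I _ ih =>
    simp only [Finset.coe_insert, Set.biUnion_insert]
    refine hU _ _ ?_ ih
    have h1 : ((fun x : ℝ => (x : EReal)) ⁻¹' {e.1, e.2}).Finite :=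
      Set.Finite.preimage EReal.coe_injective.injOn (Set.toFinite _)
    refine h1.subset ((continuous_coe_real_ereal.frontier_preimage_subset (Set.Ioo e.1 e.2)).trans
      (Set.preimage_mono ?_))
    rcases lt_or_ge e.1 e.2 with h | h
    · rw [frontier_Ioo h]
    · simp [Set.Ioo_eq_empty_of_le h]

theorem finite_of_countable_of_frontier_finite {s : Set ℝ} (hs : s.Countable)
    (hf : (frontier s).Finite) : s.Finite := by
  have h : interior s = ∅ := by
    rw [interior_eq_empty_iff_dense_compl]
    exact hs.dense_compl ℝ
  refine hf.subset fun x hx => ⟨subset_closure hx, ?_⟩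
  simp [h]

theorem subset_or_disjoint_of_disjoint_frontier {X : Type*} [TopologicalSpace X] {s J : Set X}
    (hJ : IsPreconnected J) (h : Disjoint J (frontier s)) : J ⊆ s ∨ Disjoint J s := by
  rcases Set.eq_empty_or_nonempty (J ∩ sᶜ) with h1 | h1
  · left
    intro x hx
    by_contra hxs
    exact (h1 ▸ (⟨hx, hxs⟩ : x ∈ J ∩ sᶜ) : x ∈ (∅ : Set X))
  · right
    rw [Set.disjoint_iff_inter_eq_empty]
    by_contra h2
    have hc : J ⊆ interior s ∪ interior sᶜ := by
      intro x hx
      by_contra hxx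
      refine Set.disjoint_left.1 h hx ?_
      rw [frontier_eq_closure_inter_closure, closure_eq_compl_interior_compl (s := s),
        closure_compl]
      exact ⟨fun h => hxx (Or.inr h), fun h => hxx (Or.inl h)⟩
    obtain ⟨x, hxJ, hxs⟩ := Set.nonempty_iff_ne_empty.2 h2
    obtain ⟨y, hyJ, hys⟩ := h1
    obtain ⟨z, -, hz1, hz2⟩ := hJ _ _ isOpen_interior isOpen_interior hc
      ⟨x, hxJ, (hc hxJ).resolve_right fun h => interior_subset h hxs⟩
      ⟨y, hyJ, (hc hyJ).resolve_left fun h => hys (interior_subset h)⟩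
    exact interior_subset hz2 (interior_subset hz1)

/-- `f` is at most `f t` just to the left of `t` and at least `f t` just to the right. -/
def LocallyIncreasingAt (f : ℝ → ℝ) (t : ℝ) : Prop :=
  ∃ p, p < t ∧ ∃ q, t < q ∧ ∀ u, (p < u → u < t → ¬ f t < f u) ∧ (t < u → u < q → ¬ f u < f t)

/-- `f` is at least `f t` just to the left of `t` and at most `f t` just to the right. -/
def LocallyDecreasingAt (f : ℝ → ℝ) (t : ℝ) : Prop :=
  ∃ p, p < t ∧ ∃ q, t < q ∧ ∀ u, (p < u → u < t → ¬ f u < f t) ∧ (t < u → u < q → ¬ f t < f u)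

theorem locallyIncreasingAt_neg {f : ℝ → ℝ} {t : ℝ} :
    LocallyIncreasingAt (fun u => - f u) t ↔ LocallyDecreasingAt f t := by
  simp only [LocallyIncreasingAt, LocallyDecreasingAt, neg_lt_neg_iff]

theorem monotoneOn_of_locallyIncreasingAt {f : ℝ → ℝ} {J : Set ℝ} (hJ : J.OrdConnected)
    (h : ∀ t ∈ J, LocallyIncreasingAt f t) : MonotoneOn f J := by
  intro x hx y hy hxy
  set S : Set ℝ := {w | w ∈ Set.Icc x y ∧ f x ≤ f w} with hS
  have hxS : x ∈ S := ⟨⟨le_rfl, hxy⟩, le_rfl⟩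
  have hbdd : BddAbove S := ⟨y, fun w hw => hw.1.2⟩
  set s := sSup S with hs
  have hxs : x ≤ s := le_csSup hbdd hxS
  have hsy : s ≤ y := csSup_le ⟨x, hxS⟩ fun w hw => hw.1.2
  obtain ⟨p, hp, q, hq, hpq⟩ := h s (hJ.out hx hy ⟨hxs, hsy⟩)
  have hfs : f x ≤ f s := by
    obtain ⟨u, huS, hpu⟩ := exists_lt_of_lt_csSup ⟨x, hxS⟩ hp
    rcases (le_csSup hbdd huS).eq_or_lt with hu | hu
    · rw [hs, ← hu]
      exact huS.2
    · exact huS.2.trans (not_lt.1 ((hpq u).1 hpu hu))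
  rcases hsy.eq_or_lt with h' | h'
  · rwa [← h']
  · obtain ⟨u, hu1, hu2⟩ := exists_between (lt_min hq h')
    have huS : u ∈ S := ⟨⟨hxs.trans hu1.le, (hu2.trans_le (min_le_right _ _)).le⟩,
      hfs.trans (not_lt.1 ((hpq u).2 hu1 (hu2.trans_le (min_le_left _ _))))⟩
    exact absurd (le_csSup hbdd huS) (not_le.2 hu1)

theorem antitoneOn_of_locallyDecreasingAt {f : ℝ → ℝ} {J : Set ℝ} (hJ : J.OrdConnected)
    (h : ∀ t ∈ J, LocallyDecreasingAt f t) : AntitoneOn f J := by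
  have := monotoneOn_of_locallyIncreasingAt (f := fun u => - f u) hJ
    fun t ht => locallyIncreasingAt_neg.2 (h t ht)
  intro x hx y hy hxy
  exact neg_le_neg_iff.1 (this hx hy hxy)

theorem countable_strict_local_max (f : ℝ → ℝ) :
    {t | ∃ p < t, ∃ q > t, ∀ u, p < u → u < q → u ≠ t → f u < f t}.Countable := by
  have h : {t | ∃ p < t, ∃ q > t, ∀ u, p < u → u < q → u ≠ t → f u < f t} ⊆
      ⋃ r : ℚ × ℚ, {t | (r.1 : ℝ) < t ∧ t < r.2 ∧
        ∀ u, (r.1 : ℝ) < u → u < r.2 → u ≠ t → f u < f t} := by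
    rintro t ⟨p, hp, q, hq, h⟩
    obtain ⟨p', hp1, hp2⟩ := exists_rat_btwn hp
    obtain ⟨q', hq1, hq2⟩ := exists_rat_btwn hq
    exact Set.mem_iUnion.2 ⟨(p', q'), hp2, hq1,
      fun u hu1 hu2 => h u (hp1.trans hu1) (hu2.trans hq2)⟩
  refine (Set.countable_iUnion fun r => Set.Subsingleton.countable ?_).mono h
  rintro t ⟨h1, h2, h3⟩ t' ⟨h1', h2', h3'⟩
  by_contra hne
  exact lt_asymm (h3 t' h1' h2' (Ne.symm hne)) (h3' t h1 h2 hne)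

theorem right_germ {s : Set ℝ} (hs : (frontier s).Finite) (t : ℝ) :
    ∃ q > t, (∀ u, t < u → u < q → u ∈ s) ∨ ∀ u, t < u → u < q → u ∉ s := by
  have h1 : ∀ᶠ u in 𝓝[>] t, u ∉ frontier s := by
    have h2 : (frontier s \ {t})ᶜ ∈ 𝓝 t :=
      (hs.subset Set.sdiff_subset).isClosed.isOpen_compl.mem_nhds (by simp)
    filter_upwards [mem_nhdsWithin_of_mem_nhds h2, self_mem_nhdsWithin] with u hu hu' huf
    exact hu ⟨huf, (ne_of_gt hu')⟩
  obtain ⟨q, hq, h⟩ := mem_nhdsGT_iff_exists_Ioo_subset.1 h1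
  refine ⟨q, hq, ?_⟩
  rcases subset_or_disjoint_of_disjoint_frontier (isPreconnected_Ioo (a := t) (b := q))
    (Set.disjoint_left.2 fun u hu => h hu) with h3 | h3
  · exact Or.inl fun u h1 h2 => h3 ⟨h1, h2⟩
  · exact Or.inr fun u h1 h2 => Set.disjoint_left.1 h3 ⟨h1, h2⟩

theorem left_germ {s : Set ℝ} (hs : (frontier s).Finite) (t : ℝ) :
    ∃ p < t, (∀ u, p < u → u < t → u ∈ s) ∨ ∀ u, p < u → u < t → u ∉ s := by
  have h1 : ∀ᶠ u in 𝓝[<] t, u ∉ frontier s := by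
    have h2 : (frontier s \ {t})ᶜ ∈ 𝓝 t :=
      (hs.subset Set.sdiff_subset).isClosed.isOpen_compl.mem_nhds (by simp)
    filter_upwards [mem_nhdsWithin_of_mem_nhds h2, self_mem_nhdsWithin] with u hu hu' huf
    exact hu ⟨huf, (ne_of_lt hu')⟩
  obtain ⟨p, hp, h⟩ := mem_nhdsLT_iff_exists_Ioo_subset.1 h1
  refine ⟨p, hp, ?_⟩
  rcases subset_or_disjoint_of_disjoint_frontier (isPreconnected_Ioo (a := p) (b := t))
    (Set.disjoint_left.2 fun u hu => h hu) with h3 | h3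
  · exact Or.inl fun u h1 h2 => h3 ⟨h1, h2⟩
  · exact Or.inr fun u h1 h2 => Set.disjoint_left.1 h3 ⟨h1, h2⟩

theorem countable_not_locally_monotone {f : ℝ → ℝ}
    (h1 : ∀ t, (frontier {u | f u < f t}).Finite) (h2 : ∀ t, (frontier {u | f t < f u}).Finite) :
    {t | ¬ (LocallyIncreasingAt f t ∨ LocallyDecreasingAt f t)}.Countable := by
  refine ((countable_strict_local_max f).union
    (countable_strict_local_max fun u => - f u)).mono ?_
  intro t ht
  rw [Set.mem_ofPred_eq, not_or] at ht
  obtain ⟨hi, hd⟩ := ht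
  obtain ⟨p₁, hp₁, h₁⟩ := left_germ (h1 t) t
  obtain ⟨p₂, hp₂, h₂⟩ := left_germ (h2 t) t
  obtain ⟨q₁, hq₁, h₃⟩ := right_germ (h1 t) t
  obtain ⟨q₂, hq₂, h₄⟩ := right_germ (h2 t) t
  have key1 : (∀ u, p₂ < u → u < t → ¬ f t < f u) → ∀ u, t < u → u < q₁ → f u < f t := by
    intro ha
    refine h₃.resolve_right fun hb => hi ⟨p₂, hp₂, q₁, hq₁, fun u => ⟨ha u, hb u⟩⟩
  have key2 : (∀ u, p₁ < u → u < t → ¬ f u < f t) → ∀ u, t < u → u < q₂ → f t < f u := by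
    intro ha
    refine h₄.resolve_right fun hb => hd ⟨p₁, hp₁, q₂, hq₂, fun u => ⟨ha u, hb u⟩⟩
  rcases h₂ with h₂ | h₂
  · right
    have h5 := key2 fun u hu hu' h => by
      obtain ⟨w, hw1, hw2⟩ := exists_between (max_lt hp₁ hp₂)
      have hw3 : f t < f w := h₂ w ((le_max_right _ _).trans_lt hw1) hw2
      rcases h₁ with h₁ | h₁
      · exact lt_asymm hw3 (h₁ w ((le_max_left _ _).trans_lt hw1) hw2)
      · exact h₁ u hu hu' h
    refine ⟨p₂, hp₂, q₂, hq₂, fun u hu hu' hne => neg_lt_neg ?_⟩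
    rcases hne.lt_or_gt with h | h
    · exact h₂ u hu h
    · exact h5 u h hu'
  · left
    have h5 := key1 h₂
    rcases h₁ with h₁ | h₁
    · refine ⟨p₁, hp₁, q₁, hq₁, fun u hu hu' hne => ?_⟩
      rcases hne.lt_or_gt with h | h
      · exact h₁ u hu h
      · exact h5 u h hu'
    · have h6 := key2 h₁
      obtain ⟨w, hw1, hw2⟩ := exists_between (lt_min hq₁ hq₂)
      exact absurd (h5 w hw1 (hw2.trans_le (min_le_left _ _)))
        (lt_asymm (h6 w hw1 (hw2.trans_le (min_le_right _ _))))

theorem monotoneOn_or_antitoneOn_of_disjoint {f : ℝ → ℝ} {J : Set ℝ} (hJ : J.OrdConnected)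
    (h1 : ∀ t ∈ J, LocallyIncreasingAt f t ∨ LocallyDecreasingAt f t)
    (h2 : Disjoint J (frontier {t | LocallyIncreasingAt f t})) :
    MonotoneOn f J ∨ AntitoneOn f J := by
  rcases subset_or_disjoint_of_disjoint_frontier hJ.isPreconnected h2 with h | h
  · exact Or.inl (monotoneOn_of_locallyIncreasingAt hJ h)
  · exact Or.inr (antitoneOn_of_locallyDecreasingAt hJ fun t ht =>
      (h1 t ht).resolve_left (Set.disjoint_left.1 h ht))

open MeasureTheory in
theorem lintegral_enorm_deriv_le_of_monotoneOn {f : ℝ → ℝ} {c d C : ℝ} (hcd : c ≤ d)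
    (hC : 0 ≤ C) (hf : MonotoneOn f (Set.Ioo c d)) (hb : ∀ t ∈ Set.Ioo c d, |f t| ≤ C) :
    ∫⁻ t in Set.Ioo c d, ‖deriv f t‖ₑ ≤ ENNReal.ofReal (2 * C) := by
  rcases hcd.eq_or_lt with rfl | hcd'
  · simp
  set g : ℝ → ℝ := fun t => if t ≤ c then -C else if d ≤ t then C else f t with hg
  have hgf : ∀ t ∈ Set.Ioo c d, g t = f t := fun t ht => by
    simp [hg, not_le.2 ht.1, not_le.2 ht.2]
  have hgm : Monotone g := by
    intro x y hxy
    simp only [hg]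
    split_ifs with h1 h2 h3 h4 h5 h6 h7
    · exact le_rfl
    · linarith
    · exact (abs_le.1 (hb y ⟨not_le.1 h2, not_le.1 h3⟩)).1
    · linarith
    · exact le_rfl
    · linarith
    · linarith
    · exact (abs_le.1 (hb x ⟨not_le.1 h1, not_le.1 h4⟩)).2
    · exact hf ⟨not_le.1 h1, not_le.1 h4⟩ ⟨not_le.1 ‹_›, not_le.1 ‹_›⟩ hxy
  have hgc : g c = -C := by simp [hg]
  have hgd : g d = C := by simp [hg, not_le.2 hcd']
  have hd : ∀ t ∈ Set.Ioo c d, ‖deriv f t‖ₑ = ENNReal.ofReal (deriv g t) := fun t ht => by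
    have : deriv f t = deriv g t := Filter.EventuallyEq.deriv_eq
      (Filter.eventually_of_mem (Ioo_mem_nhds ht.1 ht.2) fun u hu => (hgf u hu).symm)
    rw [this, Real.enorm_of_nonneg hgm.deriv_nonneg]
  have hm : MonotoneOn g (Set.uIcc c d) := hgm.monotoneOn _
  have hgi : IntegrableOn (deriv g) (Set.Ioo c d) := by
    have := hm.intervalIntegrable_deriv
    rw [intervalIntegrable_iff_integrableOn_Ioo_of_le hcd] at this
    exact this
  rw [setLIntegral_congr_fun measurableSet_Ioo hd,
    ← ofReal_integral_eq_lintegral_ofReal hgi (ae_of_all _ fun t => hgm.deriv_nonneg)]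
  refine ENNReal.ofReal_le_ofReal ?_
  have h := hm.intervalIntegral_deriv_mem_uIcc
  rw [intervalIntegral.integral_of_le hcd, integral_Ioc_eq_integral_Ioo, hgc, hgd,
    Set.uIcc_of_le (by linarith)] at h
  linarith [h.2]

open MeasureTheory in
theorem lintegral_enorm_deriv_le_of_finset {f : ℝ → ℝ} {C : ℝ} (hC : 0 ≤ C) (D : Finset ℝ) :
    ∀ c d : ℝ, c ≤ d → (∀ t ∈ Set.Ioo c d, |f t| ≤ C) →
      (∀ J ⊆ Set.Ioo c d, J.OrdConnected → Disjoint J (D : Set ℝ) →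
        MonotoneOn f J ∨ AntitoneOn f J) →
      ∫⁻ t in Set.Ioo c d, ‖deriv f t‖ₑ ≤ (D.card + 1 : ℕ) * ENNReal.ofReal (2 * C) := by
  induction D using Finset.strongInduction with
  | H D ih =>
    intro c d hcd hb hJ
    by_cases hD : Disjoint (Set.Ioo c d) (D : Set ℝ)
    · have h1 : ∫⁻ t in Set.Ioo c d, ‖deriv f t‖ₑ ≤ ENNReal.ofReal (2 * C) := by
        rcases hJ _ subset_rfl Set.ordConnected_Ioo hD with h | h
        · exact lintegral_enorm_deriv_le_of_monotoneOn hcd hC h hb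
        · have := lintegral_enorm_deriv_le_of_monotoneOn (f := fun t => - f t) hcd hC
            (fun x hx y hy hxy => neg_le_neg (h hx hy hxy)) (by simpa using hb)
          simpa [deriv.fun_neg] using this
      refine h1.trans (le_mul_of_one_le_left zero_le (by exact_mod_cast Nat.le_add_left 1 _))
    · obtain ⟨e, he, heD⟩ := Set.not_disjoint_iff.1 hD
      have hsub1 : Set.Ioo c e ⊆ Set.Ioo c d := Set.Ioo_subset_Ioo_right he.2.le
      have hsub2 : Set.Ioo e d ⊆ Set.Ioo c d := Set.Ioo_subset_Ioo_left he.1.le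
      have heD' : e ∈ D := heD
      have hlt1 : D.filter (· < e) ⊂ D := Finset.filter_ssubset.2 ⟨e, heD', lt_irrefl e⟩
      have hlt2 : D.filter (e < ·) ⊂ D := Finset.filter_ssubset.2 ⟨e, heD', lt_irrefl e⟩
      have h1 := ih _ hlt1 c e he.1.le (fun t ht => hb t (hsub1 ht)) fun J hJs hJo hJd =>
        hJ J (hJs.trans hsub1) hJo (Set.disjoint_left.2 fun x hx hxD =>
          Set.disjoint_left.1 hJd hx (by simpa using ⟨hxD, (hJs hx).2⟩))
      have h2 := ih _ hlt2 e d he.2.le (fun t ht => hb t (hsub2 ht)) fun J hJs hJo hJd =>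
        hJ J (hJs.trans hsub2) hJo (Set.disjoint_left.2 fun x hx hxD =>
          Set.disjoint_left.1 hJd hx (by simpa using ⟨hxD, (hJs hx).1⟩))
      have hcard : (D.filter (· < e)).card + 1 + ((D.filter (e < ·)).card + 1) ≤ D.card + 1 := by
        have hdis : Disjoint (D.filter (· < e)) (D.filter (e < ·)) :=
          Finset.disjoint_filter.2 fun x _ h h' => lt_asymm h h'
        have hss : D.filter (· < e) ∪ D.filter (e < ·) ⊂ D := by
          refine Finset.ssubset_iff_subset_ne.2 ⟨Finset.union_subset hlt1.1 hlt2.1, fun h => ?_⟩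
          rw [← h] at heD'
          simp at heD'
        have := Finset.card_lt_card hss
        rw [Finset.card_union_of_disjoint hdis] at this
        omega
      have hun : Set.Ioo c d ⊆ (Set.Ioo c e ∪ {e}) ∪ Set.Ioo e d := by
        intro x hx
        rcases lt_trichotomy x e with h | h | h
        · exact Or.inl (Or.inl ⟨hx.1, h⟩)
        · exact Or.inl (Or.inr h)
        · exact Or.inr ⟨h, hx.2⟩
      calc ∫⁻ t in Set.Ioo c d, ‖deriv f t‖ₑ
          ≤ ∫⁻ t in (Set.Ioo c e ∪ {e}) ∪ Set.Ioo e d, ‖deriv f t‖ₑ := lintegral_mono_set hun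
        _ ≤ ((∫⁻ t in Set.Ioo c e, ‖deriv f t‖ₑ) + (∫⁻ t in {e}, ‖deriv f t‖ₑ)) +
            ∫⁻ t in Set.Ioo e d, ‖deriv f t‖ₑ :=
          (lintegral_union_le _ _ _).trans (add_le_add_left (lintegral_union_le _ _ _) _)
        _ = (∫⁻ t in Set.Ioo c e, ‖deriv f t‖ₑ) + ∫⁻ t in Set.Ioo e d, ‖deriv f t‖ₑ := by simp
        _ ≤ ((D.filter (· < e)).card + 1 : ℕ) * ENNReal.ofReal (2 * C) +
            ((D.filter (e < ·)).card + 1 : ℕ) * ENNReal.ofReal (2 * C) := add_le_add h1 h2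
        _ ≤ (D.card + 1 : ℕ) * ENNReal.ofReal (2 * C) := by
          rw [← add_mul]
          gcongr
          exact_mod_cast hcard

/-- Every point of `S` is within `ρ` of exactly one point of `T`. -/
def UniquelyNear (S T : ℝ → Prop) (ρ : ℝ) : Prop :=
  ∀ z, S z → ∃ z', (T z' ∧ z < z' + ρ ∧ z' < z + ρ) ∧
    ∀ z'', (T z'' ∧ z < z'' + ρ ∧ z'' < z + ρ) → z'' = z'

theorem UniquelyNear.ncard_le {S T : ℝ → Prop} {ρ : ℝ} (hST : UniquelyNear S T ρ)
    (hTS : UniquelyNear T S ρ) (hT : {z | T z}.Finite) : {z | S z}.ncard ≤ {z | T z}.ncard := by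
  choose! f hf _ using hST
  refine Set.ncard_le_ncard_of_injOn f (fun z hz => (hf z hz).1) (fun z₁ h₁ z₂ h₂ h => ?_) hT
  obtain ⟨w, -, hw⟩ := hTS (f z₁) (hf z₁ h₁).1
  rw [hw z₁ ⟨h₁, (hf z₁ h₁).2.2, (hf z₁ h₁).2.1⟩,
    hw z₂ ⟨h₂, h ▸ (hf z₂ h₂).2.2, h ▸ (hf z₂ h₂).2.1⟩]

/-- For all `y'` near `y`, being `ρ`-close matches the fibre of `A` over `y` bijectively with the
fibre over `y'`. -/
def FiberStableAt (A : ℝ → ℝ → Prop) (y : ℝ) : Prop :=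
  ∃ ρ, 0 < ρ ∧ ∃ p, p < y ∧ ∃ q, y < q ∧ ∀ y', p < y' → y' < q →
    UniquelyNear (A y) (A y') ρ ∧ UniquelyNear (A y') (A y) ρ

theorem ncard_eq_of_disjoint_unstable {A : ℝ → ℝ → Prop} (hfin : ∀ y, {z | A y z}.Finite)
    {J : Set ℝ} (hJ : IsPreconnected J) (hs : ∀ y ∈ J, FiberStableAt A y) {y y' : ℝ}
    (hy : y ∈ J) (hy' : y' ∈ J) : {z | A y z}.ncard = {z | A y' z}.ncard := by
  refine hJ.constant (f := fun y => {z | A y z}.ncard) (fun w hw => ?_) hy hy'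
  obtain ⟨ρ, -, p, hp, q, hq, h⟩ := hs w hw
  refine (continuousAt_const.congr (f := fun _ => {z | A w z}.ncard) ?_).continuousWithinAt
  filter_upwards [Ioo_mem_nhds hp hq] with u hu
  obtain ⟨h1, h2⟩ := h u hu.1 hu.2
  exact le_antisymm (h1.ncard_le h2 (hfin u)) (h2.ncard_le h1 (hfin w))

theorem exists_separation {S : Set ℝ} (hS : S.Finite) :
    ∃ ρ > 0, ∀ z ∈ S, ∀ w ∈ S, z < w + 2 * ρ → w < z + 2 * ρ → z = w := by
  obtain ⟨C, hC, h⟩ := Set.einfsep_pos.1 hS.einfsep_pos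
  obtain ⟨D, hD, hDC⟩ := ENNReal.lt_iff_exists_nnreal_btwn.1 hC
  refine ⟨D / 2, by simpa using hD, fun z hz w hw h1 h2 => ?_⟩
  by_contra hne
  have h3 := hDC.trans_le (h z hz w hw hne)
  rw [edist_dist, ENNReal.lt_ofReal_iff_toReal_lt ENNReal.coe_ne_top, Real.dist_eq] at h3
  have h4 : |z - w| < D := abs_lt.2 ⟨by linarith, by linarith⟩
  exact lt_asymm h3 h4

theorem countable_not_fiberStableAt {L : FirstOrder.Language} [L.Structure ℝ]
    (hL : IsOMinimalOn L) {A : ℝ → ℝ → Prop}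
    (hA : DefPred L fun w : Option (Option (Fin 0)) → ℝ => A (w (some none)) (w none))
    (hfin : ∀ y, {z | A y z}.Finite) : {y | ¬ FiberStableAt A y}.Countable := by
  have hA' : ∀ {β : Type} (i j : β), DefPred L fun w : β → ℝ => A (w i) (w j) := fun i j =>
    hA.rename fun o => o.elim j fun o => o.elim i Fin.elim0
  set S₁ : ℚ × ℚ → Set ℝ := fun r => {y | ∃ z, A y z ∧ r.1 < z ∧ z < r.2} with hS₁
  set S₂ : ℚ × ℚ → Set ℝ := fun r => {y | ∀ z z', (A y z ∧ r.1 < z ∧ z < r.2) →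
    (A y z' ∧ r.1 < z' ∧ z' < r.2) → z = z'} with hS₂
  set S₃ : List (ℚ × ℚ) → Set ℝ :=
    fun l => {y | ∀ z, A y z → ∃ r ∈ l, (r.1 : ℝ) < z ∧ z < r.2} with hS₃
  have hb : ∀ {β : Type} (i j : β) (r : ℚ × ℚ),
      DefPred L fun w : β → ℝ => A (w i) (w j) ∧ r.1 < w j ∧ w j < r.2 := fun i j r =>
    (hA' i j).and ((DefPred.const_lt hL _ j).and (DefPred.lt_const hL _ j))
  have h₁ : ∀ r, (frontier (S₁ r)).Finite := fun r =>
    frontier_finite_of_definable hL (DefPred.ex (hb (some 0) none r))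
  have h₂ : ∀ r, (frontier (S₂ r)).Finite := fun r =>
    frontier_finite_of_definable hL (DefPred.all (DefPred.all
      ((hb (some (some 0)) (some none) r).imp
        ((hb (some (some 0)) none r).imp (DefPred.eq hL (some none) none)))))
  have h₃ : ∀ l, (frontier (S₃ l)).Finite := fun l =>
    frontier_finite_of_definable hL (DefPred.all ((hA' (some 0) none).imp
      (DefPred.ball_list l fun r =>
        (DefPred.const_lt hL _ none).and (DefPred.lt_const hL _ none))))
  have hc : ((⋃ r, frontier (S₁ r)) ∪ (⋃ r, frontier (S₂ r)) ∪ ⋃ l, frontier (S₃ l)).Countable :=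
    ((Set.countable_iUnion fun r => (h₁ r).countable).union
      (Set.countable_iUnion fun r => (h₂ r).countable)).union
      (Set.countable_iUnion fun l => (h₃ l).countable)
  refine hc.mono fun y hy => ?_
  by_contra hyn
  simp only [Set.mem_union, Set.mem_iUnion, not_or, not_exists] at hyn
  obtain ⟨⟨n₁, n₂⟩, n₃⟩ := hyn
  have hmem : ∀ {S : Set ℝ}, y ∉ frontier S → y ∈ S → S ∈ 𝓝 y := fun hf hS =>
    mem_interior_iff_mem_nhds.1 (by_contra fun h => hf ⟨subset_closure hS, h⟩)
  refine hy ?_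
  obtain ⟨ρ, hρ, hsep⟩ := exists_separation (hfin y)
  have hsep' : ∀ {z w u}, A y z → A y w → z < u + ρ → u < z + ρ → w < u + ρ → u < w + ρ → z = w :=
    fun hz hw h1 h2 h3 h4 => hsep _ hz _ hw (by linarith) (by linarith)
  have hex : ∀ z : ℝ, ∃ r : ℚ × ℚ, z - ρ < r.1 ∧ (r.1 : ℝ) < z ∧ z < r.2 ∧ (r.2 : ℝ) < z + ρ := by
    intro z
    obtain ⟨p, hp⟩ := exists_rat_btwn (sub_lt_self z hρ)
    obtain ⟨q, hq⟩ := exists_rat_btwn (lt_add_of_pos_right z hρ)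
    exact ⟨(p, q), hp.1, hp.2, hq.1, hq.2⟩
  choose r hr using hex
  have m₁ : ∀ z ∈ {z | A y z}, S₁ (r z) ∈ 𝓝 y := fun z hz =>
    hmem (n₁ _) ⟨z, hz, (hr z).2.1, (hr z).2.2.1⟩
  have m₂ : ∀ z ∈ {z | A y z}, S₂ (r z) ∈ 𝓝 y := fun z hz => by
    refine hmem (n₂ _) fun w w' hw hw' => ?_
    have h := hr z
    exact hsep' (u := z) hw.1 hw'.1 (by linarith) (by linarith) (by linarith) (by linarith)
  have m₃ : S₃ ((hfin y).toFinset.toList.map r) ∈ 𝓝 y := by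
    refine hmem (n₃ _) fun z hz => ⟨r z, ?_, (hr z).2.1, (hr z).2.2.1⟩
    exact List.mem_map_of_mem (by simpa using hz)
  have hev := ((Filter.biInter_mem (hfin y)).2 m₁)
  have hev' := ((Filter.biInter_mem (hfin y)).2 m₂)
  obtain ⟨p, q, hpq, hsub⟩ := mem_nhds_iff_exists_Ioo_subset.1
    (Filter.inter_mem (Filter.inter_mem hev hev') m₃)
  refine ⟨ρ, hρ, p, hpq.1, q, hpq.2, fun y' hp' hq' => ?_⟩
  obtain ⟨⟨k₁, k₂⟩, k₃⟩ := hsub ⟨hp', hq'⟩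
  rw [Set.mem_iInter₂] at k₁ k₂
  have hcov : ∀ z', A y' z' → ∃ z, A y z ∧ (r z).1 < z' ∧ z' < (r z).2 := by
    intro z' hz'
    obtain ⟨e, he, he'⟩ := k₃ z' hz'
    obtain ⟨z, hz, rfl⟩ := List.mem_map.1 he
    exact ⟨z, by simpa using hz, he'⟩
  constructor
  · intro z hz
    obtain ⟨z', hz', h1, h2⟩ := k₁ z hz
    have hz3 := hr z
    refine ⟨z', ⟨hz', by linarith, by linarith⟩, fun z'' h => ?_⟩
    obtain ⟨w, hw, hw1, hw2⟩ := hcov z'' h.1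
    have hw3 := hr w
    have : z = w := hsep' (u := z'') hz hw h.2.1 h.2.2 (by linarith) (by linarith)
    subst this
    exact k₂ z hz z'' z' ⟨h.1, hw1, hw2⟩ ⟨hz', h1, h2⟩
  · intro z' hz'
    obtain ⟨z, hz, h1, h2⟩ := hcov z' hz'
    have hz3 := hr z
    exact ⟨z, ⟨hz, by linarith, by linarith⟩, fun w hw =>
      hsep' (u := z') hw.1 hz hw.2.2 hw.2.1 (by linarith) (by linarith)⟩

theorem exists_representative {E : Set ℝ} (hE : E.Finite) (y : ℝ) :
    ∃ c, (c = 0 ∨ ∃ e ∈ E, c = e + 1 ∨ e = c + 1 ∨ ∃ e' ∈ E, c + c = e + e') ∧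
      (c = y ∨ Disjoint (Set.uIcc y c) E) := by
  by_cases hy : y ∈ E
  · exact ⟨y, Or.inr ⟨y, hy, Or.inr (Or.inr ⟨y, hy, rfl⟩)⟩, Or.inl rfl⟩
  have hne : ∀ x ∈ E, x ≠ y := fun x hx h => hy (h ▸ hx)
  have hfl : (E ∩ Set.Iio y).Finite := hE.subset Set.inter_subset_left
  have hfr : (E ∩ Set.Ioi y).Finite := hE.subset Set.inter_subset_left
  rcases Set.eq_empty_or_nonempty (E ∩ Set.Iio y) with hl | hl <;>
  rcases Set.eq_empty_or_nonempty (E ∩ Set.Ioi y) with hr | hr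
  · refine ⟨0, Or.inl rfl, Or.inr (Set.disjoint_left.2 fun x _ hx => ?_)⟩
    rcases (hne x hx).lt_or_gt with h | h
    · exact Set.notMem_empty x (hl ▸ ⟨hx, h⟩)
    · exact Set.notMem_empty x (hr ▸ ⟨hx, h⟩)
  · obtain ⟨e, he, hmin⟩ := Set.exists_min_image _ id hfr hr
    refine ⟨e - 1, Or.inr ⟨e, he.1, Or.inr (Or.inl (by ring))⟩,
      Or.inr (Set.disjoint_left.2 fun x hxu hx => ?_)⟩
    rcases (hne x hx).lt_or_gt with h | h
    · exact Set.notMem_empty x (hl ▸ ⟨hx, h⟩)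
    · have h1 : e ≤ x := hmin x ⟨hx, h⟩
      have h2 : y < e := he.2
      rcases Set.mem_uIcc.1 hxu with h3 | h3 <;> linarith [h3.1, h3.2]
  · obtain ⟨e, he, hmax⟩ := Set.exists_max_image _ id hfl hl
    refine ⟨e + 1, Or.inr ⟨e, he.1, Or.inl rfl⟩, Or.inr (Set.disjoint_left.2 fun x hxu hx => ?_)⟩
    rcases (hne x hx).lt_or_gt with h | h
    · have h1 : x ≤ e := hmax x ⟨hx, h⟩
      have h2 : e < y := he.2
      rcases Set.mem_uIcc.1 hxu with h3 | h3 <;> linarith [h3.1, h3.2]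
    · exact Set.notMem_empty x (hr ▸ ⟨hx, h⟩)
  · obtain ⟨e, he, hmax⟩ := Set.exists_max_image _ id hfl hl
    obtain ⟨e', he', hmin⟩ := Set.exists_min_image _ id hfr hr
    have h2 : e < y := he.2
    have h2' : y < e' := he'.2
    refine ⟨(e + e') / 2, Or.inr ⟨e, he.1, Or.inr (Or.inr ⟨e', he'.1, by ring⟩)⟩,
      Or.inr (Set.disjoint_left.2 fun x hxu hx => ?_)⟩
    rcases (hne x hx).lt_or_gt with h | h
    · have h1 : x ≤ e := hmax x ⟨hx, h⟩
      rcases Set.mem_uIcc.1 hxu with h3 | h3 <;> linarith [h3.1, h3.2]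
    · have h1 : e' ≤ x := hmin x ⟨hx, h⟩
      rcases Set.mem_uIcc.1 hxu with h3 | h3 <;> linarith [h3.1, h3.2]

theorem finite_representatives {E : Set ℝ} (hE : E.Finite) :
    {c : ℝ | c = 0 ∨ ∃ e ∈ E, c = e + 1 ∨ e = c + 1 ∨ ∃ e' ∈ E, c + c = e + e'}.Finite := by
  refine ((((Set.finite_singleton (0 : ℝ)).union (hE.image (· + 1))).union
    (hE.image (· - 1))).union ((hE.prod hE).image fun e => (e.1 + e.2) / 2)).subset ?_
  rintro c (rfl | ⟨e, he, rfl | rfl | ⟨e', he', h⟩⟩)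
  · simp
  · exact Or.inl (Or.inl (Or.inr ⟨e, he, rfl⟩))
  · exact Or.inl (Or.inr ⟨c + 1, he, by simp⟩)
  · exact Or.inr ⟨(e, e'), ⟨he, he'⟩, by simp only; linarith⟩

theorem DefPred.uniquelyNear {L : FirstOrder.Language} [L.Structure ℝ] (hL : IsOMinimalOn L)
    {α : Type} [Finite α] {S T : (α → ℝ) → ℝ → Prop}
    (hS : DefPred L fun w : Option α → ℝ => S (fun i => w (some i)) (w none))
    (hT : DefPred L fun w : Option α → ℝ => T (fun i => w (some i)) (w none)) (k : α) :
    DefPred L fun v => UniquelyNear (S v) (T v) (v k) := by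
  have hnear : DefPred L fun w : Option (Option α) → ℝ =>
      T (fun i => w (some (some i))) (w none) ∧ w (some none) < w none + w (some (some k)) ∧
        w none < w (some none) + w (some (some k)) :=
    (DefPred.rel T hT _ _).and ((DefPred.lt_add hL _ _ _).and (DefPred.lt_add hL _ _ _))
  refine DefPred.all (hS.imp (DefPred.ex (hnear.and (DefPred.all (DefPred.imp ?_ ?_)))))
  · exact hnear.rename fun o => o.elim none fun o => o.elim (some (some none)) fun i =>
      some (some (some i))
  · exact DefPred.eq hL _ _

theorem DefPred.fiberStableAt {L : FirstOrder.Language} [L.Structure ℝ] (hL : IsOMinimalOn L)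
    {α : Type} [Finite α] {A : (α → ℝ) → ℝ → ℝ → Prop}
    (hA : DefPred L fun w : Option (Option α) → ℝ =>
      A (fun i => w (some (some i))) (w (some none)) (w none)) :
    DefPred L fun w : Option α → ℝ => FiberStableAt (A fun i => w (some i)) (w none) := by
  refine DefPred.ex ((DefPred.const_lt hL 0 _).and (DefPred.ex ((DefPred.lt hL _ _).and
    (DefPred.ex ((DefPred.lt hL _ _).and (DefPred.all ((DefPred.lt hL _ _).imp
      ((DefPred.lt hL _ _).imp (DefPred.and ?_ ?_)))))))))
  · exact DefPred.uniquelyNear hL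
      (S := fun v z => A (fun i => v (some (some (some (some (some i))))))
        (v (some (some (some (some none))))) z)
      (T := fun v z => A (fun i => v (some (some (some (some (some i)))))) (v none) z)
      (DefPred.rel₂ A hA _ _ _) (DefPred.rel₂ A hA _ _ _) (some (some (some none)))
  · exact DefPred.uniquelyNear hL
      (T := fun v z => A (fun i => v (some (some (some (some (some i))))))
        (v (some (some (some (some none))))) z)
      (S := fun v z => A (fun i => v (some (some (some (some (some i)))))) (v none) z)
      (DefPred.rel₂ A hA _ _ _) (DefPred.rel₂ A hA _ _ _) (some (some (some none)))

/-- **Uniform finiteness**: a definable family of finite sets of reals has uniformly bounded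
cardinality. -/
theorem uniform_finiteness {L : FirstOrder.Language} [L.Structure ℝ] (hL : IsOMinimalOn L)
    (α : Type) [Finite α] : ∀ A : (α → ℝ) → ℝ → Prop,
      (DefPred L fun w : Option α → ℝ => A (fun i => w (some i)) (w none)) →
      (∀ v, {z | A v z}.Finite) → ∃ N : ℕ, ∀ v, {z | A v z}.ncard ≤ N := by
  induction α using Finite.induction_empty_option with
  | @of_equiv α β e ih =>
    intro A hA hfin
    obtain ⟨N, hN⟩ := ih (fun v => A fun i => v (e.symm i)) (DefPred.rel A hA _ _)
      fun v => hfin _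
    exact ⟨N, fun v => by simpa using hN fun i => v (e i)⟩
  | h_empty =>
    intro A _ _
    exact ⟨{z | A (fun i => i.elim) z}.ncard, fun v => by
      rw [Subsingleton.elim v fun i => i.elim]⟩
  | @h_option α _ ih =>
    intro A hA hfin
    set B : (α → ℝ) → ℝ → ℝ → Prop := fun v y z => A (fun o => o.elim y v) z with hB_def
    have hB : DefPred L fun w : Option (Option α) → ℝ =>
        B (fun i => w (some (some i))) (w (some none)) (w none) := by
      refine (congrArg (DefPred L) (funext fun w => ?_)).mp hA
      exact congrArg (fun u => A u (w none)) (funext fun o => by cases o <;> rfl)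
    set E : (α → ℝ) → ℝ → Prop := fun v y => ¬ FiberStableAt (B v) y with hE_def
    have hE : DefPred L fun w : Option α → ℝ => E (fun i => w (some i)) (w none) :=
      (DefPred.fiberStableAt hL hB).not
    have hEfin : ∀ v, {y | E v y}.Finite := fun v =>
      finite_of_countable_of_frontier_finite
        (countable_not_fiberStableAt hL
          (hB.subst fun o => o.elim (Sum.inl none) fun o => o.elim (Sum.inl (some none))
            fun i => Sum.inr (v i)) fun y => hfin _)
        (frontier_finite_of_definable hL (DefPred.fiber E hE v))
    set R : (α → ℝ) → ℝ → Prop := fun v c => c = 0 ∨ ∃ e, E v e ∧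
      (c = e + 1 ∨ e = c + 1 ∨ ∃ e', E v e' ∧ c + c = e + e') with hR_def
    have hR : DefPred L fun w : Option α → ℝ => R (fun i => w (some i)) (w none) :=
      (DefPred.eq_const hL _ _).or (DefPred.ex ((DefPred.rel E hE _ _).and
        ((DefPred.eq_add_const hL _ _ _).or ((DefPred.eq_add_const hL _ _ _).or
          (DefPred.ex ((DefPred.rel E hE _ _).and (DefPred.add_eq_add hL _ _ _ _)))))))
    have hRfin : ∀ v, {c | R v c}.Finite := fun v => finite_representatives (hEfin v)
    have hUfin : ∀ v, {z | ∃ c, R v c ∧ B v c z}.Finite := fun v => by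
      refine ((hRfin v).biUnion (t := fun c => {z | B v c z}) fun c _ => hfin _).subset ?_
      rintro z ⟨c, hc, hz⟩
      exact Set.mem_iUnion₂.2 ⟨c, hc, hz⟩
    obtain ⟨N, hN⟩ := ih (fun v z => ∃ c, R v c ∧ B v c z)
      (DefPred.ex ((DefPred.rel R hR _ _).and (DefPred.rel₂ B hB _ _ _))) hUfin
    refine ⟨N, fun w => ?_⟩
    set v : α → ℝ := fun i => w (some i) with hv
    have hw : w = fun o => o.elim (w none) v := by
      funext o
      cases o <;> rfl
    obtain ⟨c, hc, hcy⟩ := exists_representative (hEfin v) (w none)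
    have hcard : {z | B v (w none) z}.ncard = {z | B v c z}.ncard := by
      rcases hcy with rfl | hd
      · rfl
      · exact ncard_eq_of_disjoint_unstable (fun y => hfin _) Set.ordConnected_uIcc.isPreconnected
          (fun y hy => not_not.1 fun h => Set.disjoint_left.1 hd hy h)
          Set.left_mem_uIcc Set.right_mem_uIcc
    calc {z | A w z}.ncard = {z | B v (w none) z}.ncard :=
        congrArg (fun u => {z | A u z}.ncard) hw
      _ = {z | B v c z}.ncard := hcard
      _ ≤ {z | ∃ c, R v c ∧ B v c z}.ncard :=
        Set.ncard_le_ncard (fun z hz => ⟨c, hc, hz⟩) (hUfin v)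
      _ ≤ N := hN v

theorem mem_frontier_iff_forall_exists {s : Set ℝ} {t : ℝ} :
    t ∈ frontier s ↔ ∀ p, p < t → ∀ q, t < q →
      (∃ u, (p < u ∧ u < q) ∧ u ∈ s) ∧ ∃ u, (p < u ∧ u < q) ∧ u ∉ s := by
  rw [frontier_eq_closure_inter_closure, Set.mem_inter_iff,
    mem_closure_iff_nhds_basis (nhds_basis_Ioo t), mem_closure_iff_nhds_basis (nhds_basis_Ioo t)]
  constructor
  · rintro ⟨h1, h2⟩ p hp q hq
    obtain ⟨u, hu, hu'⟩ := h1 (p, q) ⟨hp, hq⟩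
    obtain ⟨v, hv, hv'⟩ := h2 (p, q) ⟨hp, hq⟩
    exact ⟨⟨u, hu', hu⟩, v, hv', hv⟩
  · intro h
    constructor
    · rintro ⟨p, q⟩ ⟨hp, hq⟩
      obtain ⟨u, hu, hu'⟩ := (h p hp q hq).1
      exact ⟨u, hu', hu⟩
    · rintro ⟨p, q⟩ ⟨hp, hq⟩
      obtain ⟨u, hu, hu'⟩ := (h p hp q hq).2
      exact ⟨u, hu', hu⟩

namespace DefPred

variable {L : FirstOrder.Language} [L.Structure ℝ] {α : Type} [Finite α]

theorem mem_frontier (hL : IsOMinimalOn L) (P : (α → ℝ) → ℝ → Prop)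
    (hP : DefPred L fun w : Option α → ℝ => P (fun i => w (some i)) (w none)) :
    DefPred L fun w : Option α → ℝ => w none ∈ frontier {t | P (fun i => w (some i)) t} := by
  simp only [mem_frontier_iff_forall_exists]
  exact all ((lt hL _ _).imp (all ((lt hL _ _).imp
    ((ex (((lt hL _ _).and (lt hL _ _)).and (rel P hP _ _))).and
      (ex (((lt hL _ _).and (lt hL _ _)).and (rel P hP _ _).not))))))

theorem locallyIncreasingAt (hL : IsOMinimalOn L) (F : (α → ℝ) → ℝ → ℝ)
    (hF : DefPred L fun w : Option (Option α) → ℝ =>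
      F (fun i => w (some (some i))) (w (some none)) < F (fun i => w (some (some i))) (w none)) :
    DefPred L fun w : Option α → ℝ => LocallyIncreasingAt (F fun i => w (some i)) (w none) := by
  have hr (σ : α → Option (Option (Option (Option α)))) := rel₂ (fun v t u => F v t < F v u) hF σ
  exact ex ((lt hL _ _).and (ex ((lt hL _ _).and (all
    (((lt hL _ _).imp ((lt hL _ _).imp (hr _ _ _).not)).and
      ((lt hL _ _).imp ((lt hL _ _).imp (hr _ _ _).not)))))))

theorem locallyDecreasingAt (hL : IsOMinimalOn L) (F : (α → ℝ) → ℝ → ℝ)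
    (hF : DefPred L fun w : Option (Option α) → ℝ =>
      F (fun i => w (some (some i))) (w (some none)) < F (fun i => w (some (some i))) (w none)) :
    DefPred L fun w : Option α → ℝ => LocallyDecreasingAt (F fun i => w (some i)) (w none) := by
  have hr (σ : α → Option (Option (Option (Option α)))) := rel₂ (fun v t u => F v t < F v u) hF σ
  exact ex ((lt hL _ _).and (ex ((lt hL _ _).and (all
    (((lt hL _ _).imp ((lt hL _ _).imp (hr _ _ _).not)).and
      ((lt hL _ _).imp ((lt hL _ _).imp (hr _ _ _).not)))))))

end DefPred

/-- The monotonicity theorem, with a bound on the number of exceptional points that is uniform in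
the parameters. -/
theorem uniform_monotonicity {L : FirstOrder.Language} [L.Structure ℝ] (hL : IsOMinimalOn L)
    {α : Type} [Finite α] (F : (α → ℝ) → ℝ → ℝ)
    (hF : DefPred L fun w : Option (Option α) → ℝ =>
      F (fun i => w (some (some i))) (w (some none)) < F (fun i => w (some (some i))) (w none)) :
    ∃ N : ℕ, ∀ v, ∃ D : Finset ℝ, D.card ≤ N ∧ ∀ J : Set ℝ, J.OrdConnected → Disjoint J ↑D →
      MonotoneOn (F v) J ∨ AntitoneOn (F v) J := by
  have hI := DefPred.locallyIncreasingAt hL F hF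
  have hM := (hI.or (DefPred.locallyDecreasingAt hL F hF)).not
  have hfr := DefPred.mem_frontier hL (fun v t => LocallyIncreasingAt (F v) t) hI
  have hfin : ∀ v, {t | ¬ (LocallyIncreasingAt (F v) t ∨ LocallyDecreasingAt (F v) t) ∨
      t ∈ frontier {t | LocallyIncreasingAt (F v) t}}.Finite := by
    intro v
    refine Set.Finite.union (finite_of_countable_of_frontier_finite
      (countable_not_locally_monotone (fun t => ?_) fun t => ?_) ?_) ?_
    · exact frontier_finite_of_definable hL (p := fun u => F v u < F v t)
        (hF.subst fun o => o.elim (Sum.inr t) fun o => o.elim (Sum.inl 0) fun i => Sum.inr (v i))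
    · exact frontier_finite_of_definable hL (p := fun u => F v t < F v u)
        (hF.subst fun o => o.elim (Sum.inl 0) fun o => o.elim (Sum.inr t) fun i => Sum.inr (v i))
    · exact frontier_finite_of_definable hL (DefPred.fiber
        (fun v t => ¬ (LocallyIncreasingAt (F v) t ∨ LocallyDecreasingAt (F v) t)) hM v)
    · exact frontier_finite_of_definable hL
        (DefPred.fiber (fun v t => LocallyIncreasingAt (F v) t) hI v)
  obtain ⟨N, hN⟩ := uniform_finiteness hL α
    (fun v t => ¬ (LocallyIncreasingAt (F v) t ∨ LocallyDecreasingAt (F v) t) ∨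
      t ∈ frontier {t | LocallyIncreasingAt (F v) t}) (hM.or hfr) hfin
  refine ⟨N, fun v => ⟨(hfin v).toFinset, ?_, fun J hJ hd => ?_⟩⟩
  · rw [← Set.ncard_eq_toFinset_card _ (hfin v)]
    exact hN v
  · rw [Set.Finite.coe_toFinset] at hd
    refine monotoneOn_or_antitoneOn_of_disjoint hJ (fun t ht => ?_) ?_
    · exact not_not.1 fun h => Set.disjoint_left.1 hd ht (Or.inl h)
    · exact hd.mono_right fun t ht => Or.inr ht

theorem integral_abs_deriv_le_of_finset {f : ℝ → ℝ} {a b C : ℝ} (hab : a ≤ b) (hC : 0 ≤ C)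
    (D : Finset ℝ) (hf : ∀ t ∈ Set.Ioo a b, |f t| ≤ C)
    (hD : ∀ J ⊆ Set.Ioo a b, J.OrdConnected → Disjoint J ↑D → MonotoneOn f J ∨ AntitoneOn f J) :
    ∫ t in Set.Ioo a b, |deriv f t| ≤ (D.card + 1) * (2 * C) := by
  have h := lintegral_enorm_deriv_le_of_finset hC D a b hab hf hD
  rw [MeasureTheory.integral_eq_lintegral_of_nonneg_ae
    (Filter.Eventually.of_forall fun t => abs_nonneg _)
    (measurable_deriv f).norm.aestronglyMeasurable]
  refine ENNReal.toReal_le_of_le_ofReal (by positivity) ?_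
  rw [ENNReal.ofReal_mul (by positivity), ← Nat.cast_succ, ENNReal.ofReal_natCast]
  refine le_trans (le_of_eq ?_) h
  simp only [← Real.norm_eq_abs, ofReal_norm]

/-- **Proposition 5 (Uniform integrability lemma).** If `φ(x,t,s)` is definable on
`Q × (a,b) × (0,1)` and `φ(x,t,s) → 0` as `s → 0+` uniformly on `Q × (a,b)`, then
`∫ₐᵇ |φ_t(x,t,s)| dt → 0` as `s → 0+` uniformly on `Q`, where `φ_t` denotes the partial
derivative in `t` (taken to be `0` where it does not exist, as in Mathlib's `deriv`). -/
theorem uniform_integrability_lemma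
    {n : ℕ} (L : FirstOrder.Language) [L.Structure ℝ] (hL : IsOMinimalOn L)
    (Q : Set (EuclideanSpace ℝ (Fin n))) (hQdef : DefinableT L (codeE Q))
    (a b : ℝ) (hab : a < b)
    (φ : EuclideanSpace ℝ (Fin n) → ℝ → ℝ → ℝ)
    (hφdef : DefinableT L {v : Fin n ⊕ Fin 3 → ℝ |
      ((WithLp.equiv 2 (Fin n → ℝ)).symm fun i => v (Sum.inl i)) ∈ Q ∧
      v (Sum.inr 0) ∈ Set.Ioo a b ∧ v (Sum.inr 1) ∈ Set.Ioo (0 : ℝ) 1 ∧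
      v (Sum.inr 2) = φ ((WithLp.equiv 2 (Fin n → ℝ)).symm fun i => v (Sum.inl i))
        (v (Sum.inr 0)) (v (Sum.inr 1))})
    (hunif : ∀ ε > (0 : ℝ), ∃ δ > (0 : ℝ), ∀ x ∈ Q, ∀ t ∈ Set.Ioo a b,
      ∀ s ∈ Set.Ioo (0 : ℝ) 1, s < δ → |φ x t s| ≤ ε) :
    ∀ ε > (0 : ℝ), ∃ δ > (0 : ℝ), ∀ x ∈ Q, ∀ s ∈ Set.Ioo (0 : ℝ) 1, s < δ →
      (∫ t in Set.Ioo a b, |deriv (fun u => φ x u s) t|) ≤ ε := by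
  classical
  let pt : (Option (Fin n) → ℝ) → EuclideanSpace ℝ (Fin n) := fun v =>
    (WithLp.equiv 2 (Fin n → ℝ)).symm fun i => v (some i)
  let R : (Option (Fin n) → ℝ) → ℝ → ℝ → Prop := fun v t y =>
    pt v ∈ Q ∧ t ∈ Set.Ioo a b ∧ v none ∈ Set.Ioo (0 : ℝ) 1 ∧ y = φ (pt v) t (v none)
  let ψ : (Option (Fin n) → ℝ) → ℝ → ℝ := fun v t =>
    if pt v ∈ Q ∧ t ∈ Set.Ioo a b ∧ v none ∈ Set.Ioo (0 : ℝ) 1 then φ (pt v) t (v none) else 0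
  have hR : DefPred L fun w : Option (Option (Option (Fin n))) → ℝ =>
      R (fun i => w (some (some i))) (w (some none)) (w none) :=
    DefPred.rename (L := L) hφdef
      (Sum.elim (fun i => some (some (some i))) ![some none, some (some none), none])
  have hψ : ∀ v t y, (R v t y ∨ (¬ ∃ z, R v t z) ∧ y = 0) ↔ y = ψ v t := by
    intro v t y
    by_cases h : pt v ∈ Q ∧ t ∈ Set.Ioo a b ∧ v none ∈ Set.Ioo (0 : ℝ) 1
    · have hz : ∃ z, R v t z := ⟨_, h.1, h.2.1, h.2.2, rfl⟩
      simp only [hz, not_true_eq_false, false_and, or_false, ψ, if_pos h]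
      exact ⟨fun h' => h'.2.2.2, fun h' => ⟨h.1, h.2.1, h.2.2, h'⟩⟩
    · have hR' : ∀ z, ¬ R v t z := fun z hz => h ⟨hz.1, hz.2.1, hz.2.2.1⟩
      simp only [hR', exists_false, not_false_eq_true, true_and, false_or, ψ, if_neg h]
  have hG : DefPred L fun w : Option (Option (Option (Fin n))) → ℝ =>
      w none = ψ (fun i => w (some (some i))) (w (some none)) := by
    simp only [← hψ]
    exact hR.or ((DefPred.ex
      (DefPred.rel₂ R hR (fun i => some (some (some i))) (some (some none)) none)).not.and
        (DefPred.eq_const hL _ _))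
  have hlt : DefPred L fun w : Option (Option (Option (Fin n))) → ℝ =>
      ψ (fun i => w (some (some i))) (w (some none)) < ψ (fun i => w (some (some i))) (w none) := by
    have h : DefPred L fun w : Option (Option (Option (Fin n))) → ℝ =>
        ∃ y, y = ψ (fun i => w (some (some i))) (w (some none)) ∧
          ∃ z, z = ψ (fun i => w (some (some i))) (w none) ∧ y < z :=
      DefPred.ex ((DefPred.rel₂ (fun v t y => y = ψ v t) hG
        (fun i => some (some (some i))) (some (some none)) none).and
        (DefPred.ex ((DefPred.rel₂ (fun v t y => y = ψ v t) hG
          (fun i => some (some (some (some i)))) (some (some none)) none).and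
            (DefPred.lt hL (some none) none))))
    simpa only [exists_eq_left] using h
  obtain ⟨N, hN⟩ := uniform_monotonicity hL ψ hlt
  intro ε hε
  obtain ⟨δ, hδ, hφ⟩ := hunif (ε / (2 * (N + 1))) (by positivity)
  refine ⟨δ, hδ, fun x hx s hs hsδ => ?_⟩
  obtain ⟨D, hD, hmono⟩ := hN fun o => o.elim s fun i => x i
  have hψx : ∀ t ∈ Set.Ioo a b, ψ (fun o => o.elim s fun i => x i) t = φ x t s :=
    fun t ht => if_pos ⟨hx, ht, hs⟩
  have hC : 0 ≤ ε / (2 * ((N : ℝ) + 1)) := by positivity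
  calc ∫ t in Set.Ioo a b, |deriv (fun u => φ x u s) t|
      ≤ (D.card + 1) * (2 * (ε / (2 * ((N : ℝ) + 1)))) := by
        refine integral_abs_deriv_le_of_finset hab.le hC D
          (fun t ht => hφ x hx t ht s hs hsδ) fun J hJ hJc hJD => ?_
        exact (hmono J hJc hJD).imp (fun h => h.congr fun t ht => hψx t (hJ ht))
          fun h => h.congr fun t ht => hψx t (hJ ht)
    _ ≤ (N + 1) * (2 * (ε / (2 * ((N : ℝ) + 1)))) := by gcongr
    _ = ε := by field_simp
end
end
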